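/- arXiv:1112.0128 — 3 statements merged into one kernel-verified Lean document; each statement's English description precedes it below -/
import Mathlib

section
/- Let n ≥ 2 and let p be a prime. For every x ∈ ℙ^{n-1}(ℚ_p) and every τ ∈ ℚ_p with |τ|_p ≥ 1 there exists a point y ∈ ℙ^{n-1}(ℚ) such that H_e(y) ≤ c(n)·|τ|_p^{n-1} and δ_p(x, y) ≤ c(n)·(|τ|_p · H_e(y))^{-1}, where c(n) = 2·π^{-1/2}·Γ(n/2 + 1)^{1/n}. -/
open MeasureTheory

noncomputable section

/-- The p-adic projective distance (at vector level): the sup-norm of the wedge product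
divided by the product of sup norms.  Invariant under scaling, it descends to
projective space. -/
def padicDelta (p : ℕ) [Fact p.Prime] {n : ℕ} (x y : Fin n → ℚ_[p]) : ℝ :=
  (⨆ ij : Fin n × Fin n, ‖x ij.1 * y ij.2 - x ij.2 * y ij.1‖) / (‖x‖ * ‖y‖)

instance (p : ℕ) [Fact p.Prime] (n : ℕ) : MeasurableSpace (Fin n → ℚ_[p]) := borel _
instance (p : ℕ) [Fact p.Prime] (n : ℕ) : BorelSpace (Fin n → ℚ_[p]) := ⟨rfl⟩

/-- `ℤ_p^n` as a positive compact subset of `ℚ_p^n`. -/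
def padicUnitPC (p : ℕ) [Fact p.Prime] (n : ℕ) :
    TopologicalSpace.PositiveCompacts (Fin n → ℚ_[p]) where
  carrier := {x | ∀ i, ‖x i‖ ≤ 1}
  isCompact' := by
    have : {x : Fin n → ℚ_[p] | ∀ i, ‖x i‖ ≤ 1} = Set.univ.pi fun _ => Metric.closedBall 0 1 := by
      ext x; simp [Metric.mem_closedBall, dist_eq_norm]
    rw [this]
    exact isCompact_univ_pi fun i => isCompact_closedBall 0 1
  interior_nonempty' := by
    refine ⟨0, ?_⟩
    rw [mem_interior]
    refine ⟨Metric.ball 0 1, fun x hx i => ?_, Metric.isOpen_ball, by simp⟩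
    have hx' : ‖x‖ < 1 := by simpa [dist_eq_norm] using hx
    exact le_of_lt (lt_of_le_of_lt (norm_le_pi_norm x i) hx')

/-- Haar measure on `ℚ_p^n`, normalized so that `ℤ_p^n` has measure one. -/
def padicHaar (p : ℕ) [Fact p.Prime] (n : ℕ) : Measure (Fin n → ℚ_[p]) :=
  Measure.addHaarMeasure (padicUnitPC p n)

/-- The natural probability measure `μ_p` on `ℙ^{n-1}(ℚ_p)`:
`μ_p(M) = β(φ⁻¹(M) ∩ ℤ_p^n)`. -/
def muP (p : ℕ) [Fact p.Prime] (n : ℕ)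
    (M : Set (Projectivization ℚ_[p] (Fin n → ℚ_[p]))) : ENNReal :=
  padicHaar p n {x | (∀ i, ‖x i‖ ≤ 1) ∧ ∃ hx : x ≠ 0, Projectivization.mk ℚ_[p] x hx ∈ M}

/-- A visible (primitive) integer vector: the gcd of its coordinates is 1. -/
def IsPrim {n : ℕ} (v : Fin n → ℤ) : Prop := Finset.univ.gcd v = 1

/-- The sup-norm height of an integer vector. -/
def Hsup {n : ℕ} (v : Fin n → ℤ) : ℕ := Finset.univ.sup fun i => (v i).natAbs

/-- Embedding of an integer vector into `ℚ_p^n`. -/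
def intPadic (p : ℕ) [Fact p.Prime] {n : ℕ} (v : Fin n → ℤ) : Fin n → ℚ_[p] :=
  fun i => ((v i : ℤ) : ℚ_[p])

/-- Embedding of an integer vector into `ℚ^n`. -/
def intRat {n : ℕ} (v : Fin n → ℤ) : Fin n → ℚ := fun i => ((v i : ℤ) : ℚ)

/-- The set `W_p(ψ, ℚ, n)` of points of `ℙ^{n-1}(ℚ_p)` admitting infinitely many
rational approximations `y` with `δ_p(x,y) ≤ ψ(H(y))`. -/
def Wp (p : ℕ) [Fact p.Prime] (n : ℕ) (ψ : ℕ → ℝ) :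
    Set (Projectivization ℚ_[p] (Fin n → ℚ_[p])) :=
  {x | {y : Projectivization ℚ (Fin n → ℚ) | ∃ v : Fin n → ℤ, IsPrim v ∧
      (∃ hv : intRat v ≠ 0, y = Projectivization.mk ℚ (intRat v) hv) ∧
      padicDelta p x.rep (intPadic p v) ≤ ψ (Hsup v)}.Infinite}

/-- Closed ball for the projective metric, centered at the class of the vector `y`. -/
def Bdelta (p : ℕ) [Fact p.Prime] {n : ℕ} (y : Fin n → ℚ_[p]) (r : ℝ) :
    Set (Projectivization ℚ_[p] (Fin n → ℚ_[p])) :=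
  {z | padicDelta p z.rep y ≤ r}

/-- The Euclidean norm of a vector in `ℝ^n`. -/
noncomputable def eNorm {n : ℕ} (x : Fin n → ℝ) : ℝ := Real.sqrt (∑ i, (x i) ^ 2)

/-- Norm of the wedge product of two vectors in `ℝ^n`:
`‖x ∧ y‖² = Σ_{i<j} (x_i y_j − x_j y_i)²`. -/
noncomputable def wedgeNorm {n : ℕ} (x y : Fin n → ℝ) : ℝ :=
  Real.sqrt (∑ ij ∈ Finset.univ.filter (fun ij : Fin n × Fin n => ij.1 < ij.2),
    (x ij.1 * y ij.2 - x ij.2 * y ij.1) ^ 2)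

/-- The projective distance at the infinite place (vector level):
`δ_∞(x,y) = ‖x ∧ y‖ / (‖x‖‖y‖)`. Invariant under scaling, it descends to `ℙ^{n-1}(ℝ)`. -/
noncomputable def deltaInf {n : ℕ} (x y : Fin n → ℝ) : ℝ :=
  wedgeNorm x y / (eNorm x * eNorm y)

/-- Embedding of an integer vector into `ℝ^n`. -/
noncomputable def intReal {n : ℕ} (v : Fin n → ℤ) : Fin n → ℝ := fun i => ((v i : ℤ) : ℝ)

/-- The natural probability measure `μ_∞` on `ℙ^{n-1}(ℝ)`:
`μ_∞(M) = λ(φ⁻¹(M) ∩ B(0,1)) / λ(B(0,1))`. -/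
noncomputable def muInf (n : ℕ) (M : Set (Projectivization ℝ (Fin n → ℝ))) : ENNReal :=
  MeasureTheory.volume {x : Fin n → ℝ | eNorm x ≤ 1 ∧
      ∃ hx : x ≠ 0, Projectivization.mk ℝ x hx ∈ M} /
    MeasureTheory.volume {x : Fin n → ℝ | eNorm x ≤ 1}

/-- The set `W_∞(ψ, ℚ, n)` of points of `ℙ^{n-1}(ℝ)` admitting infinitely many
rational approximations `y` with `δ_∞(x,y) ≤ ψ(H(y))`. -/
noncomputable def Winf (n : ℕ) (ψ : ℕ → ℝ) : Set (Projectivization ℝ (Fin n → ℝ)) :=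
  {x | {y : Projectivization ℚ (Fin n → ℚ) | ∃ v : Fin n → ℤ, IsPrim v ∧
      (∃ hv : intRat v ≠ 0, y = Projectivization.mk ℚ (intRat v) hv) ∧
      deltaInf x.rep (intReal v) ≤ ψ (Hsup v)}.Infinite}

/-- The Choi–Vaaler constant `c(n) = 2·π^{-1/2}·Γ(n/2+1)^{1/n}` for `k = ℚ`. -/
noncomputable def cCV (n : ℕ) : ℝ :=
  2 * Real.pi ^ (-(1/2 : ℝ)) * Real.Gamma ((n : ℝ) / 2 + 1) ^ ((1 : ℝ) / n)

/-- The Euclidean height of a primitive integer vector. -/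
noncomputable def He {n : ℕ} (v : Fin n → ℤ) : ℝ := eNorm (intReal v)

end

theorem cCV_pow {n : ℕ} (hn : n ≠ 0) :
    cCV n ^ n = 2 ^ n * (Real.Gamma ((n : ℝ) / 2 + 1) / √Real.pi ^ n) := by
  have hΓ : 0 ≤ Real.Gamma ((n : ℝ) / 2 + 1) := (Real.Gamma_pos_of_pos (by positivity)).le
  rw [cCV, mul_pow, mul_pow, one_div (n : ℝ), Real.rpow_inv_natCast_pow hΓ hn,
    Real.rpow_neg Real.pi_pos.le, ← Real.sqrt_eq_rpow, inv_pow]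
  ring

theorem cCV_pos (n : ℕ) : 0 < cCV n := by
  have hΓ : 0 < Real.Gamma ((n : ℝ) / 2 + 1) := Real.Gamma_pos_of_pos (by positivity)
  have := Real.pi_pos
  unfold cCV
  positivity

theorem eNorm_eq_norm {n : ℕ} (x : EuclideanSpace ℝ (Fin n)) : eNorm x.ofLp = ‖x‖ := by
  simp [eNorm, EuclideanSpace.norm_eq]

/-- Minkowski's theorem for the Euclidean ball and the lattice `B ℤ^n`. -/
theorem exists_ne_zero_He_mulVec_le {n : ℕ} (hn : n ≠ 0) (B : Matrix (Fin n) (Fin n) ℤ)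
    (hB : B.det ≠ 0) {R : ℝ} (hR : 0 ≤ R) (h : cCV n ^ n * |(B.det : ℝ)| ≤ R ^ n) :
    ∃ s : Fin n → ℤ, s ≠ 0 ∧ He (B.mulVec s) ≤ R := by
  have : NeZero n := ⟨hn⟩
  set A : Matrix (Fin n) (Fin n) ℝ := B.map (Int.cast : ℤ → ℝ) with hA
  have hAdet : A.det = (B.det : ℝ) := by
    rw [hA]
    exact ((Int.castRingHom ℝ).map_det B).symm
  have hd : (B.det : ℝ) ≠ 0 := by exact_mod_cast hB
  have hAu : IsUnit A.det := by rw [hAdet]; exact hd.isUnit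
  set g : (Fin n → ℝ) →ₗ[ℝ] (Fin n → ℝ) := Matrix.toLin' A⁻¹ with hg
  set f : EuclideanSpace ℝ (Fin n) →ₗ[ℝ] (Fin n → ℝ) :=
    (WithLp.linearEquiv 2 ℝ (Fin n → ℝ)).toLinearMap
  set K : Set (EuclideanSpace ℝ (Fin n)) := Metric.closedBall 0 R with hK
  have hvol : volume (f '' K) =
      ENNReal.ofReal R ^ n * ENNReal.ofReal (√Real.pi ^ n / Real.Gamma (n / 2 + 1)) := by
    have h1 : f '' K = (WithLp.toLp 2 : (Fin n → ℝ) → _) ⁻¹' K := by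
      ext z
      constructor
      · rintro ⟨w, hw, rfl⟩
        exact hw
      · intro hz
        exact ⟨_, hz, rfl⟩
    rw [h1, (PiLp.volume_preserving_toLp (Fin n)).measure_preimage
      Metric.isClosed_closedBall.measurableSet.nullMeasurableSet,
      EuclideanSpace.volume_closedBall, Fintype.card_fin]
  have hgdet : LinearMap.det g = (B.det : ℝ)⁻¹ := by
    rw [hg, LinearMap.det_toLin', Matrix.det_nonsing_inv, hAdet, Ring.inverse_eq_inv']
  have hfund := ZSpan.isAddFundamentalDomain' (Pi.basisFun ℝ (Fin n)) volume
  have : Countable (Submodule.span ℤ (Set.range (Pi.basisFun ℝ (Fin n)))).toAddSubgroup := by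
    change Countable (Submodule.span ℤ (Set.range (Pi.basisFun ℝ (Fin n))))
    infer_instance
  have : DiscreteTopology (Submodule.span ℤ
      (Set.range (Pi.basisFun ℝ (Fin n)))).toAddSubgroup := by
    change DiscreteTopology (Submodule.span ℤ (Set.range (Pi.basisFun ℝ (Fin n))))
    infer_instance
  have hF : volume (ZSpan.fundamentalDomain (Pi.basisFun ℝ (Fin n))) = 1 := by
    simp [-ZSpan.volume_fundamentalDomain, ZSpan.fundamentalDomain_pi_basisFun, volume_pi_pi]
  have hsymm : ∀ z ∈ g '' (f '' K), -z ∈ g '' (f '' K) := by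
    rintro _ ⟨_, ⟨w, hw, rfl⟩, rfl⟩
    exact ⟨_, ⟨-w, by simpa [hK] using hw, rfl⟩, by simp⟩
  have hconv : Convex ℝ (g '' (f '' K)) :=
    ((convex_closedBall _ _).linear_image f).linear_image g
  have hcpt : IsCompact (g '' (f '' K)) :=
    ((isCompact_closedBall _ _).image f.continuous_of_finiteDimensional).image
      g.continuous_of_finiteDimensional
  have hmeas : volume (ZSpan.fundamentalDomain (Pi.basisFun ℝ (Fin n))) *
      2 ^ Module.finrank ℝ (Fin n → ℝ) ≤ volume (g '' (f '' K)) := by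
    rw [Measure.addHaar_image_linearMap, hgdet, hvol, hF, one_mul, Module.finrank_fin_fun,
      ← ENNReal.ofReal_pow hR, ← ENNReal.ofReal_mul (by positivity), ← ENNReal.ofReal_mul (by positivity),
      show (2 : ENNReal) ^ n = ENNReal.ofReal (2 ^ n) by
        rw [ENNReal.ofReal_pow zero_le_two, ENNReal.ofReal_ofNat]]
    apply ENNReal.ofReal_le_ofReal
    have hΓ : 0 < Real.Gamma ((n : ℝ) / 2 + 1) := Real.Gamma_pos_of_pos (by positivity)
    have hπ : 0 < √Real.pi ^ n := by have := Real.pi_pos; positivity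
    have hd' : 0 < |(B.det : ℝ)| := abs_pos.2 hd
    rw [cCV_pow hn] at h
    rw [abs_inv]
    calc (2 : ℝ) ^ n = |(B.det : ℝ)|⁻¹ * ((2 ^ n * (Real.Gamma ((n : ℝ) / 2 + 1) / √Real.pi ^ n) *
          |(B.det : ℝ)|) * (√Real.pi ^ n / Real.Gamma (n / 2 + 1))) := by field_simp
      _ ≤ _ := by gcongr
  obtain ⟨⟨z, hz⟩, hz0, hzmem⟩ := exists_ne_zero_mem_lattice_of_measure_mul_two_pow_le_measure
    hfund hsymm hconv hcpt hmeas
  obtain ⟨u, ⟨w, hw, rfl⟩, hgw⟩ := hzmem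
  have hz' := ((Pi.basisFun ℝ (Fin n)).mem_span_iff_repr_mem ℤ z).1 hz
  choose s hs using hz'
  have hzs : z = intReal s := by
    ext i
    simpa [intReal] using (hs i).symm
  have hAz : A.mulVec z = w.ofLp := by
    have : z = A⁻¹.mulVec w.ofLp := hgw.symm
    rw [this, Matrix.mulVec_mulVec, Matrix.mul_nonsing_inv _ hAu, Matrix.one_mulVec]
  refine ⟨s, ?_, ?_⟩
  · rintro rfl
    apply hz0
    ext i
    simp [hzs, intReal]
  · have : intReal (B.mulVec s) = w.ofLp := by
      rw [← hAz, hzs]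
      ext i
      simp [intReal, hA, Matrix.mulVec, dotProduct]
    rw [He, this, eNorm_eq_norm]
    simpa [hK] using hw

theorem det_updateCol_diagonal {ι R : Type*} [Fintype ι] [DecidableEq ι] [CommRing R]
    (d b : ι → R) (i : ι) :
    ((Matrix.diagonal d).updateCol i b).det = (∏ j ∈ Finset.univ.erase i, d j) * b i := by
  rw [← Matrix.cramer_apply, Matrix.cramer_eq_adjugate_mulVec, Matrix.adjugate_diagonal,
    Matrix.mulVec_diagonal]

theorem updateCol_diagonal_mulVec {ι R : Type*} [Fintype ι] [DecidableEq ι] [CommRing R]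
    (d b s : ι → R) (i j : ι) :
    ((Matrix.diagonal d).updateCol i b).mulVec s j =
      s i * b j + if j = i then 0 else d j * s j := by
  rw [Matrix.mulVec, dotProduct, ← Finset.add_sum_erase _ _ (Finset.mem_univ i)]
  congr 1
  · simp [mul_comm]
  · rw [Finset.sum_congr rfl (g := fun k => if j = k then d j * s j else 0)]
    · rw [Finset.sum_ite_eq]
      split_ifs <;> simp_all
    · intro k hk
      rw [Matrix.updateCol_ne (Finset.ne_of_mem_erase hk), Matrix.diagonal_apply]
      split_ifs with h
      · rw [h]
      · simp

/-- A `p`-adic integer is congruent to a rational integer modulo `p ^ k`. -/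
theorem exists_int_norm_sub_le (p : ℕ) [Fact p.Prime] {x : ℚ_[p]} (hx : ‖x‖ ≤ 1) (k : ℕ) :
    ∃ a : ℤ, ‖x - a‖ ≤ (p : ℝ) ^ (-k : ℤ) := by
  obtain ⟨y, rfl⟩ : ∃ y : ℤ_[p], (y : ℚ_[p]) = x := ⟨⟨x, hx⟩, rfl⟩
  refine ⟨(PadicInt.appr y k : ℕ), ?_⟩
  have := (PadicInt.norm_le_pow_iff_mem_span_pow _ k).2 (PadicInt.appr_spec k y)
  rw [PadicInt.norm_def, PadicInt.coe_sub, PadicInt.coe_natCast] at this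
  exact_mod_cast this

theorem norm_mul_sub_mul_le {K ι : Type*} [NormedField K] [IsUltrametricDist K]
    {x v : ι → K} (hx : ∀ i, ‖x i‖ ≤ 1) (t : K) {ε : ℝ} (h : ∀ i, ‖v i - t * x i‖ ≤ ε) (i j : ι) :
    ‖x i * v j - x j * v i‖ ≤ ε := by
  have hmul (a b : ι) : ‖x a * (v b - t * x b)‖ ≤ ε := by
    rw [norm_mul]
    exact (mul_le_of_le_one_left (norm_nonneg _) (hx a)).trans (h b)
  rw [show x i * v j - x j * v i = x i * (v j - t * x j) - x j * (v i - t * x i) by ring,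
    sub_eq_add_neg]
  exact (IsUltrametricDist.norm_add_le_max _ _).trans
    (max_le (hmul i j) ((norm_neg _).trans_le (hmul j i)))

/-- A nonzero integer vector of small height whose image is close to the line through `x`. -/
theorem exists_He_le_norm_wedge_le {n : ℕ} (p : ℕ) [Fact p.Prime] {x : Fin n → ℚ_[p]}
    (hx : x ≠ 0) (m : ℕ) :
    ∃ v : Fin n → ℤ, v ≠ 0 ∧ He v ≤ cCV n * ((p : ℝ) ^ m) ^ (n - 1) ∧
      ∀ i j, ‖x i * intPadic p v j - x j * intPadic p v i‖ ≤
        ‖x‖ * (p : ℝ) ^ (-(m * n : ℕ) : ℤ) := by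
  have hp : p.Prime := Fact.out
  have hn : n ≠ 0 := by
    rintro rfl
    exact hx (Subsingleton.elim _ _)
  have : Nonempty (Fin n) := Fin.pos_iff_nonempty.1 (Nat.pos_of_ne_zero hn)
  obtain ⟨i₀, hi₀⟩ : ∃ i, ‖x i‖ = ‖x‖ := by
    obtain ⟨i, hi⟩ := exists_eq_ciSup_of_finite (f := fun i => ‖x i‖)
    refine ⟨i, le_antisymm (norm_le_pi_norm x i) ?_⟩
    rw [pi_norm_le_iff_of_nonneg (norm_nonneg _)]
    intro j
    rw [hi]
    exact le_ciSup (Set.finite_range fun i => ‖x i‖).bddAbove j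
  have hxi₀ : x i₀ ≠ 0 := by
    rw [← norm_ne_zero_iff, hi₀]
    exact norm_ne_zero_iff.2 hx
  set x' : Fin n → ℚ_[p] := fun i => x i / x i₀ with hx'
  have hx'1 (i) : ‖x' i‖ ≤ 1 := by
    rw [hx', norm_div, hi₀]
    exact div_le_one_of_le₀ (norm_le_pi_norm x i) (norm_nonneg _)
  set k := m * n with hk
  choose a ha using fun i => exists_int_norm_sub_le p (hx'1 i) k
  set y := Function.update a i₀ 1 with hy
  have hy1 : y i₀ = 1 := by simp [hy]
  have hyx (i) : ‖x' i - y i‖ ≤ (p : ℝ) ^ (-k : ℤ) := by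
    obtain rfl | hi := eq_or_ne i i₀
    · simp only [hy1, hx', div_self hxi₀, Int.cast_one, sub_self, norm_zero]
      positivity
    · simpa [hy, hi] using ha i
  set B := (Matrix.diagonal fun _ : Fin n => (p : ℤ) ^ k).updateCol i₀ y with hB
  have hdet : B.det = ((p : ℤ) ^ k) ^ (n - 1) := by
    rw [hB, det_updateCol_diagonal, hy1, mul_one, Finset.prod_const,
      Finset.card_erase_of_mem (Finset.mem_univ _), Finset.card_univ, Fintype.card_fin]
  have hdet0 : B.det ≠ 0 := by
    rw [hdet]
    exact pow_ne_zero _ (pow_ne_zero _ (by exact_mod_cast hp.ne_zero))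
  obtain ⟨s, hs0, hs⟩ := exists_ne_zero_He_mulVec_le hn B hdet0
    (R := cCV n * ((p : ℝ) ^ m) ^ (n - 1)) (mul_nonneg (cCV_pos n).le (by positivity)) <| by
      rw [hdet, hk, mul_pow]
      push_cast
      rw [abs_of_nonneg (by positivity)]
      apply le_of_eq
      ring
  refine ⟨B.mulVec s, ?_, hs, fun i j => ?_⟩
  · intro h0
    exact hs0 (Matrix.eq_zero_of_mulVec_eq_zero hdet0 h0)
  · have key := norm_mul_sub_mul_le (v := intPadic p (B.mulVec s)) hx'1 (s i₀ : ℚ_[p])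
      (ε := (p : ℝ) ^ (-k : ℤ)) (fun i => ?_) i j
    · have : x i * intPadic p (B.mulVec s) j - x j * intPadic p (B.mulVec s) i =
          x i₀ * (x' i * intPadic p (B.mulVec s) j - x' j * intPadic p (B.mulVec s) i) := by
        simp only [hx']
        field_simp
      rw [this, norm_mul, hi₀]
      gcongr
    · simp only [intPadic, hB, updateCol_diagonal_mulVec]
      have hle (z w : ℤ) (c : ℚ_[p]) (hc : ‖c‖ ≤ (p : ℝ) ^ (-k : ℤ)) :
          ‖(z : ℚ_[p]) * c + ((p : ℤ) ^ k * w : ℤ)‖ ≤ (p : ℝ) ^ (-k : ℤ) := by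
        refine (IsUltrametricDist.norm_add_le_max _ _).trans (max_le ?_ ?_)
        · rw [norm_mul]
          exact (mul_le_of_le_one_left (norm_nonneg _) (Padic.norm_int_le_one z)).trans hc
        · exact (Padic.norm_int_le_pow_iff_dvd _ k).2 (Dvd.intro _ rfl)
      have h2 := hle (s i₀) (if i = i₀ then 0 else s i) (y i - x' i)
        (by rw [norm_sub_rev]; exact hyx i)
      refine le_of_eq_of_le (congrArg norm ?_) h2
      split_ifs <;> push_cast <;> ring

theorem norm_intPadic_eq_one {n : ℕ} (p : ℕ) [Fact p.Prime] {v : Fin n → ℤ} (hv : IsPrim v) :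
    ‖intPadic p v‖ = 1 := by
  apply le_antisymm
  · exact (pi_norm_le_iff_of_nonneg zero_le_one).2 fun i => Padic.norm_int_le_one _
  · by_contra! h
    have hdvd : (p : ℤ) ∣ Finset.univ.gcd v := Finset.dvd_gcd fun i _ =>
      Padic.norm_intCast_lt_one_iff.1 ((norm_le_pi_norm (intPadic p v) i).trans_lt h)
    rw [hv] at hdvd
    exact (Nat.prime_iff_prime_int.1 Fact.out).not_dvd_one hdvd

theorem He_mul {n : ℕ} (d : ℤ) (v : Fin n → ℤ) : He (fun i => d * v i) = |(d : ℝ)| * He v := by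
  simp only [He, eNorm, intReal, Int.cast_mul, mul_pow, ← Finset.mul_sum]
  rw [Real.sqrt_mul (sq_nonneg _), Real.sqrt_sq_eq_abs]

theorem He_pos {n : ℕ} {v : Fin n → ℤ} (hv : v ≠ 0) : 0 < He v := by
  obtain ⟨i, hi⟩ := Function.ne_iff.1 hv
  have hi' : (v i : ℝ) ≠ 0 := by exact_mod_cast hi
  exact Real.sqrt_pos.2 (Finset.sum_pos' (fun _ _ => sq_nonneg _)
    ⟨i, Finset.mem_univ _, sq_pos_of_ne_zero hi'⟩)

theorem one_le_abs_mul_norm_intCast (p : ℕ) [Fact p.Prime] {d : ℤ} (hd : d ≠ 0) :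
    1 ≤ |(d : ℝ)| * ‖(d : ℚ_[p])‖ := by
  have hp : 0 < (p : ℝ) := by exact_mod_cast (Fact.out : p.Prime).pos
  have hd' : (d : ℚ_[p]) ≠ 0 := by exact_mod_cast hd
  rw [Padic.norm_eq_zpow_neg_valuation hd', Padic.valuation_intCast, zpow_neg, zpow_natCast,
    ← div_eq_mul_inv, one_le_div (by positivity)]
  have h := Int.le_of_dvd (abs_pos.2 hd) ((dvd_abs _ _).2 (padicValInt_dvd (p := p) d))
  exact_mod_cast h

/-- Choi–Vaaler projective Dirichlet theorem for `ℚ` at a finite place `p`. -/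
theorem projective_dirichlet_padic (n p : ℕ) (hn : 2 ≤ n) [Fact p.Prime]
    (x : Projectivization ℚ_[p] (Fin n → ℚ_[p])) (τ : ℚ_[p]) (hτ : 1 ≤ ‖τ‖) :
    ∃ v : Fin n → ℤ, IsPrim v ∧
      He v ≤ cCV n * ‖τ‖ ^ (n - 1) ∧
      padicDelta p x.rep (intPadic p v) ≤ cCV n * (‖τ‖ * He v)⁻¹ := by
  have hp1 : (1 : ℝ) < p := by exact_mod_cast (Fact.out : p.Prime).one_lt
  have hp : 0 < (p : ℝ) := zero_lt_one.trans hp1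
  have hx := x.rep_nonzero
  set X := x.rep
  have hX : 0 < ‖X‖ := norm_pos_iff.2 hx
  obtain ⟨m, hm⟩ : ∃ m : ℕ, ‖τ‖ = (p : ℝ) ^ m := by
    have hτ0 : τ ≠ 0 := norm_pos_iff.1 (zero_lt_one.trans_le hτ)
    rw [Padic.norm_eq_zpow_neg_valuation hτ0] at hτ ⊢
    obtain ⟨m, hm⟩ := Int.eq_ofNat_of_zero_le ((one_le_zpow_iff_right₀ hp1).1 hτ)
    exact ⟨m, by rw [hm, zpow_natCast]⟩
  obtain ⟨u, hu0, hu, hwedge⟩ := exists_He_le_norm_wedge_le p hx m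
  have : Nonempty (Fin n) := ⟨⟨0, by omega⟩⟩
  obtain ⟨v, huv, hv⟩ := Finset.extract_gcd u (Finset.univ_nonempty (α := Fin n))
  generalize Finset.univ.gcd u = d at huv
  obtain rfl : u = fun i => d * v i := funext fun i => huv i (Finset.mem_univ i)
  have hd0 : d ≠ 0 := by
    intro h
    exact hu0 (by ext i; simp [h])
  have hv0 : v ≠ 0 := by
    rintro rfl
    exact hu0 (by ext i; simp)
  have hHv := He_pos hv0
  have hd1 : (1 : ℝ) ≤ |(d : ℝ)| := by exact_mod_cast Int.one_le_abs hd0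
  rw [He_mul] at hu
  have hdn := one_le_abs_mul_norm_intCast p hd0
  have hdelta : padicDelta p X (intPadic p v) ≤ |(d : ℝ)| * (p : ℝ) ^ (-(m * n : ℕ) : ℤ) := by
    rw [padicDelta, norm_intPadic_eq_one p hv, mul_one, div_le_iff₀ hX]
    refine ciSup_le fun ij => ?_
    have h := hwedge ij.1 ij.2
    have hfac : X ij.1 * intPadic p (fun i => d * v i) ij.2 -
        X ij.2 * intPadic p (fun i => d * v i) ij.1 =
        d * (X ij.1 * intPadic p v ij.2 - X ij.2 * intPadic p v ij.1) := by
      simp only [intPadic, Int.cast_mul]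
      ring
    rw [hfac, norm_mul] at h
    calc ‖X ij.1 * intPadic p v ij.2 - X ij.2 * intPadic p v ij.1‖
        ≤ (|(d : ℝ)| * ‖(d : ℚ_[p])‖) *
            ‖X ij.1 * intPadic p v ij.2 - X ij.2 * intPadic p v ij.1‖ :=
          le_mul_of_one_le_left (norm_nonneg _) hdn
      _ ≤ |(d : ℝ)| * (‖X‖ * (p : ℝ) ^ (-(m * n : ℕ) : ℤ)) := by
          rw [mul_assoc]
          gcongr
      _ = _ := by ring
  refine ⟨v, hv, ?_, hdelta.trans ?_⟩
  · rw [hm]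
    exact (le_mul_of_one_le_left hHv.le hd1).trans hu
  · have hpow : ((p : ℝ) ^ m) ^ (n - 1) * (p : ℝ) ^ m = (p : ℝ) ^ (m * n) := by
      rw [← pow_succ, Nat.sub_add_cancel (by omega), pow_mul]
    rw [hm, ← div_eq_mul_inv, le_div_iff₀ (by positivity), zpow_neg, zpow_natCast]
    calc |(d : ℝ)| * ((p : ℝ) ^ (m * n))⁻¹ * ((p : ℝ) ^ m * He v)
        = (|(d : ℝ)| * He v) * ((p : ℝ) ^ m * ((p : ℝ) ^ (m * n))⁻¹) := by ring
      _ ≤ (cCV n * ((p : ℝ) ^ m) ^ (n - 1)) * ((p : ℝ) ^ m * ((p : ℝ) ^ (m * n))⁻¹) := by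
          gcongr
      _ = cCV n * ((((p : ℝ) ^ m) ^ (n - 1) * (p : ℝ) ^ m) * ((p : ℝ) ^ (m * n))⁻¹) := by ring
      _ = cCV n := by rw [hpow, mul_inv_cancel₀ (by positivity), mul_one]
end

section
/- Let n ≥ 2, let p be a prime, and let ψ : ℕ → [0,∞) be any function. If the series Σ_{q=1}^∞ q^{n-1} ψ(q)^{n-1} converges, then μ_p(W_p(ψ, ℚ, n)) = 0. -/
open MeasureTheory

section ProjectiveConvergence

open Filter Finset
open scoped ENNReal

/-- The part of the tube of radius `r` around the line spanned by `w` that lies in `ℤ_p^n`; for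
`w k = 1` the coordinate `x k` parametrizes the line. -/
def padicTube (p : ℕ) [Fact p.Prime] {n : ℕ} (w : Fin n → ℚ_[p]) (k : Fin n) (r : ℝ) :
    Set (Fin n → ℚ_[p]) :=
  {x | (∀ i, ‖x i‖ ≤ 1) ∧ ∀ i, ‖x i - x k * w i‖ ≤ r}

lemma isClosed_padicTube (p : ℕ) [Fact p.Prime] {n : ℕ} (w : Fin n → ℚ_[p]) (k : Fin n) (r : ℝ) :
    IsClosed (padicTube p w k r) := by
  simp only [padicTube, Set.ofPred_and, Set.ofPred_forall]
  refine (isClosed_iInter fun i => ?_).inter (isClosed_iInter fun i => ?_)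
  · exact isClosed_le (by fun_prop) continuous_const
  · exact isClosed_le (by fun_prop) continuous_const

lemma padicHaar_unit (p : ℕ) [Fact p.Prime] (n : ℕ) :
    padicHaar p n {x | ∀ i, ‖x i‖ ≤ 1} = 1 :=
  Measure.addHaarMeasure_self (K₀ := padicUnitPC p n)

instance (p : ℕ) [Fact p.Prime] (n : ℕ) : (padicHaar p n).IsAddLeftInvariant := by
  unfold padicHaar; infer_instance

/-- The vector with natural number coordinates `a` off the coordinate `k`, and `0` at `k`. -/
noncomputable def natShift (p : ℕ) [Fact p.Prime] {n : ℕ} (k : Fin n) {N : ℕ}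
    (a : {i // i ≠ k} → Fin N) :
    Fin n → ℚ_[p] :=
  fun i => if h : i ≠ k then ((a ⟨i, h⟩ : ℕ) : ℚ_[p]) else 0

lemma norm_natShift_le (p : ℕ) [Fact p.Prime] {n : ℕ} (k : Fin n) {N : ℕ}
    (a : {i // i ≠ k} → Fin N) (i : Fin n) : ‖natShift p k a i‖ ≤ 1 := by
  unfold natShift
  split_ifs
  · simpa using Padic.norm_int_le_one (p := p) ((a ⟨i, ‹_›⟩ : ℕ) : ℤ)
  · simp

/-- The tube has `p ^ (m * (n - 1))` disjoint translates inside `ℤ_p^n`. -/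
lemma padicHaar_padicTube_mul_le (p : ℕ) [Fact p.Prime] {n : ℕ} (w : Fin n → ℚ_[p]) (k : Fin n)
    (r : ℝ) (m : ℕ) (hr : r < (p : ℝ) ^ (-(m : ℤ) + 1)) :
    ((p ^ m) ^ (n - 1) : ℕ) * padicHaar p n (padicTube p w k r) ≤ 1 := by
  have hdisj : Pairwise (Function.onFun Disjoint fun a : {i // i ≠ k} → Fin (p ^ m) =>
      (fun x => natShift p k a + x) ⁻¹' padicTube p w k r) := by
    intro a b hab
    refine Set.disjoint_left.2 fun x hx hy => hab ?_
    funext ⟨i, hi⟩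
    have h1 := hx.2 i
    have h2 := hy.2 i
    simp only [Pi.add_apply, natShift, hi, ne_eq, not_false_eq_true, dite_true, not_true,
      dite_false, zero_add] at h1 h2
    have h3 : ‖(((a ⟨i, hi⟩ : ℕ) - (b ⟨i, hi⟩ : ℕ) : ℤ) : ℚ_[p])‖ ≤ r := by
      rw [← norm_neg] at h2
      have h := (IsUltrametricDist.norm_add_le_max _ _).trans (max_le h1 h2)
      ring_nf at h
      simpa using h
    have h4 := (Padic.norm_int_le_pow_iff_dvd _ m).1
      ((Padic.norm_le_pow_iff_norm_lt_pow_add_one _ _).2 (h3.trans_lt hr))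
    have h5 := Int.eq_zero_of_abs_lt_dvd h4 (by
      have := (a ⟨i, hi⟩).2
      have := (b ⟨i, hi⟩).2
      rw [abs_lt]
      zify at *
      constructor <;> linarith)
    exact Fin.ext (by omega)
  have hmeas := tsum_meas_le_meas_iUnion_of_disjoint (padicHaar p n) (fun a =>
    ((isClosed_padicTube p w k r).preimage (continuous_const_add (natShift p k a))).measurableSet)
    hdisj
  simp only [measure_preimage_add] at hmeas
  have hcard : ENat.card ({i // i ≠ k} → Fin (p ^ m)) = ((p ^ m) ^ (n - 1) : ℕ) := by
    rw [ENat.card_eq_coe_fintype_card]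
    simp [Fintype.card_subtype_compl]
  rw [ENNReal.tsum_const, hcard] at hmeas
  refine le_trans (by simpa using hmeas) ((measure_mono ?_).trans (padicHaar_unit p n).le)
  refine Set.iUnion_subset fun a x hx i => ?_
  have h := IsUltrametricDist.norm_add_le_max (natShift p k a i + x i) (-natShift p k a i)
  rw [norm_neg, add_neg_cancel_comm] at h
  exact h.trans (max_le (hx.1 i) (norm_natShift_le p k a i))

lemma padicHaar_padicTube_le_of_pos (p : ℕ) [Fact p.Prime] {n : ℕ} (w : Fin n → ℚ_[p]) (k : Fin n)
    {r : ℝ} (hr : 0 < r) :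
    padicHaar p n (padicTube p w k r) ≤ ENNReal.ofReal (r ^ (n - 1)) := by
  rcases le_or_gt 1 r with h1 | h1
  · calc padicHaar p n (padicTube p w k r) ≤ padicHaar p n {x | ∀ i, ‖x i‖ ≤ 1} :=
          measure_mono fun x hx => hx.1
      _ = ENNReal.ofReal 1 := by simp [padicHaar_unit]
      _ ≤ _ := ENNReal.ofReal_le_ofReal (one_le_pow₀ h1)
  have hp : 1 < (p : ℝ) := mod_cast (Fact.out : p.Prime).one_lt
  obtain ⟨z, hz1, hz2⟩ := exists_mem_Ico_zpow hr hp
  have hz : z < 0 := by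
    by_contra! h
    exact (hz1.trans_lt h1).not_ge (one_le_zpow₀ hp.le h)
  obtain ⟨m, rfl⟩ : ∃ m : ℕ, z = -(m : ℤ) := ⟨z.natAbs, by omega⟩
  have h := padicHaar_padicTube_mul_le p w k r m hz2
  have hpos : 0 < (p ^ m) ^ (n - 1) := pow_pos (pow_pos (Fact.out : p.Prime).pos _) _
  have h' : padicHaar p n (padicTube p w k r) ≤ (((p ^ m) ^ (n - 1) : ℕ) : ℝ≥0∞)⁻¹ := by
    rw [ENNReal.le_inv_iff_mul_le, mul_comm]
    exact h
  refine h'.trans ?_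
  rw [← ENNReal.ofReal_natCast, ← ENNReal.ofReal_inv_of_pos (mod_cast hpos)]
  refine ENNReal.ofReal_le_ofReal ?_
  rw [zpow_neg, zpow_natCast] at hz1
  push_cast
  rw [← inv_pow]
  exact pow_le_pow_left₀ (by positivity) hz1 _

lemma padicHaar_padicTube_le (p : ℕ) [Fact p.Prime] {n : ℕ} (w : Fin n → ℚ_[p])
    (k : Fin n) {r : ℝ} (hr : 0 ≤ r) :
    padicHaar p n (padicTube p w k r) ≤ ENNReal.ofReal (r ^ (n - 1)) := by
  have hcont : Continuous fun s : ℝ => ENNReal.ofReal (s ^ (n - 1)) :=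
    ENNReal.continuous_ofReal.comp (continuous_pow _)
  refine ge_of_tendsto (hcont.continuousWithinAt (s := Set.Ioi r) (x := r)).tendsto ?_
  filter_upwards [self_mem_nhdsWithin] with s hs
  exact (measure_mono fun x (hx : x ∈ padicTube p w k r) =>
    (⟨hx.1, fun i => (hx.2 i).trans (le_of_lt hs)⟩ : x ∈ padicTube p w k s)).trans
    (padicHaar_padicTube_le_of_pos p w k (hr.trans_lt hs))

lemma IsPrim.exists_norm_eq_one {p : ℕ} [Fact p.Prime] {n : ℕ} {v : Fin n → ℤ} (hv : IsPrim v) :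
    ∃ k, ‖intPadic p v k‖ = 1 := by
  by_contra! h
  have hdvd : (p : ℤ) ∣ univ.gcd v := dvd_gcd fun i _ =>
    Padic.norm_intCast_lt_one_iff.1 (lt_of_le_of_ne (Padic.norm_int_le_one _) (h i))
  rw [hv] at hdvd
  exact (Nat.prime_iff_prime_int.1 (Fact.out : p.Prime)).not_dvd_one hdvd

lemma padicDelta_smul_left {p : ℕ} [Fact p.Prime] {n : ℕ} {c : ℚ_[p]} (hc : c ≠ 0)
    (x y : Fin n → ℚ_[p]) : padicDelta p (c • x) y = padicDelta p x y := by
  have hsup : (⨆ ij : Fin n × Fin n, ‖(c • x) ij.1 * y ij.2 - (c • x) ij.2 * y ij.1‖) =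
      ‖c‖ * ⨆ ij : Fin n × Fin n, ‖x ij.1 * y ij.2 - x ij.2 * y ij.1‖ := by
    rw [Real.mul_iSup_of_nonneg (norm_nonneg c)]
    congr 1 with ij
    rw [← norm_mul]
    simp only [Pi.smul_apply, smul_eq_mul]
    ring_nf
  rw [padicDelta, padicDelta, hsup, norm_smul, mul_assoc,
    mul_div_mul_left _ _ (norm_ne_zero_iff.2 hc)]

lemma padicDelta_rep {p : ℕ} [Fact p.Prime] {n : ℕ} {x : Fin n → ℚ_[p]} (hx : x ≠ 0)
    (y : Fin n → ℚ_[p]) :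
    padicDelta p (Projectivization.mk ℚ_[p] x hx).rep y = padicDelta p x y := by
  obtain ⟨a, ha⟩ := Projectivization.exists_smul_eq_mk_rep ℚ_[p] x hx
  rw [← ha]
  exact padicDelta_smul_left a.ne_zero x y

/-- The nonzero points of `ℤ_p^n` at projective distance at most `r` from `v`, for `v` primitive. -/
def padicCone (p : ℕ) [Fact p.Prime] {n : ℕ} (v : Fin n → ℤ) (r : ℝ) : Set (Fin n → ℚ_[p]) :=
  {x | IsPrim v ∧ (∀ i, ‖x i‖ ≤ 1) ∧ x ≠ 0 ∧ padicDelta p x (intPadic p v) ≤ r}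

lemma padicCone_subset_padicTube {p : ℕ} [Fact p.Prime] {n : ℕ} {v : Fin n → ℤ} {r : ℝ}
    (hr : 0 ≤ r) {k : Fin n} (hk : ‖intPadic p v k‖ = 1) :
    padicCone p v r ⊆ padicTube p (fun i => intPadic p v i / intPadic p v k) k r := by
  rintro x ⟨-, hx1, hx0, hx⟩
  refine ⟨hx1, fun i => ?_⟩
  have hk0 : intPadic p v k ≠ 0 := norm_ne_zero_iff.1 (by simp [hk])
  have hv0 : intPadic p v ≠ 0 := fun h => hk0 (congrFun h k)
  have hxn : ‖x‖ ≤ 1 := (pi_norm_le_iff_of_nonneg zero_le_one).2 hx1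
  have hvn : ‖intPadic p v‖ ≤ 1 :=
    (pi_norm_le_iff_of_nonneg zero_le_one).2 fun i => Padic.norm_int_le_one _
  rw [padicDelta, div_le_iff₀ (mul_pos (norm_pos_iff.2 hx0) (norm_pos_iff.2 hv0))] at hx
  have hle := le_ciSup (f := fun ij : Fin n × Fin n =>
    ‖x ij.1 * intPadic p v ij.2 - x ij.2 * intPadic p v ij.1‖) (Set.finite_range _).bddAbove (i, k)
  have hrew : x i - x k * (intPadic p v i / intPadic p v k) =
      (x i * intPadic p v k - x k * intPadic p v i) / intPadic p v k := by
    field_simp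
  rw [hrew, norm_div, hk, div_one]
  exact (hle.trans hx).trans (mul_le_of_le_one_right hr (mul_le_one₀ hxn (norm_nonneg _) hvn))

lemma padicHaar_padicCone_le (p : ℕ) [Fact p.Prime] {n : ℕ} (v : Fin n → ℤ) {r : ℝ}
    (hr : 0 ≤ r) : padicHaar p n (padicCone p v r) ≤ ENNReal.ofReal (r ^ (n - 1)) := by
  by_cases hv : IsPrim v
  · obtain ⟨k, hk⟩ := hv.exists_norm_eq_one (p := p)
    exact (measure_mono (padicCone_subset_padicTube hr hk)).trans
      (padicHaar_padicTube_le p _ k hr)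
  · simp [padicCone, hv]

lemma Hsup_le_iff {n : ℕ} {v : Fin n → ℤ} {q : ℕ} : Hsup v ≤ q ↔ ∀ i, |v i| ≤ q := by
  simp only [Hsup, Finset.sup_le_iff, mem_univ, true_imp_iff]
  exact forall_congr' fun i => by rw [Int.abs_eq_natAbs, Nat.cast_le]

lemma IsPrim.Hsup_ne_zero {n : ℕ} {v : Fin n → ℤ} (hv : IsPrim v) : Hsup v ≠ 0 := by
  intro h
  have h0 : univ.gcd v = 0 := Finset.gcd_eq_zero_iff.2 fun i _ => by
    simpa using Hsup_le_iff.1 h.le i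
  rw [hv] at h0
  exact one_ne_zero h0

/-- There are `O(q^(n-1))` integer vectors of height `q`. -/
lemma encard_Hsup_fiber_le (n q : ℕ) (hq : q ≠ 0) :
    ((Hsup (n := n) ⁻¹' {q}).encard : ℝ≥0∞) ≤
      ((2 * n * 3 ^ (n - 1) * q ^ (n - 1) : ℕ) : ℝ≥0∞) := by
  obtain ⟨m, rfl⟩ := Nat.exists_eq_succ_of_ne_zero hq
  let s (k : ℕ) : Finset (Fin n → ℤ) := Fintype.piFinset fun _ => Icc (-k : ℤ) k
  have hmem (k : ℕ) (v : Fin n → ℤ) : v ∈ s k ↔ Hsup v ≤ k := by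
    simp [s, Hsup_le_iff, abs_le]
  have hfib : Hsup (n := n) ⁻¹' {m + 1} = ((s (m + 1) \ s m : Finset _) : Set (Fin n → ℤ)) := by
    ext v
    simp only [Set.mem_preimage, Set.mem_singleton_iff, coe_sdiff, Set.mem_sdiff, mem_coe, hmem]
    omega
  have hsub : s m ⊆ s (m + 1) := fun v hv => (hmem _ _).2 (((hmem _ _).1 hv).trans (by omega))
  have hcard : #(s (m + 1) \ s m) ≤ 2 * n * (2 * m + 3) ^ (n - 1) := by
    simp only [hsub, card_sdiff_of_subset, s, Fintype.card_piFinset, Int.card_Icc, prod_const]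
    grind [abs_pow_sub_pow_le (α := ℤ) (2 * m + 3) (2 * m + 1) n, Finset.card_univ,
      Fintype.card_fin]
  rw [hfib, Set.encard_coe_eq_coe_finsetCard]
  refine le_trans (b := ((2 * n * (2 * m + 3) ^ (n - 1) : ℕ) : ℝ≥0∞)) ?_ (Nat.cast_le.2 ?_)
  · exact_mod_cast hcard
  rw [mul_assoc (2 * n), ← mul_pow]
  gcongr
  omega

lemma tsum_padicHaar_padicCone_ne_top (n p : ℕ) [Fact p.Prime] (ψ : ℕ → ℝ)
    (hψ : ∀ q, 0 ≤ ψ q) (hconv : Summable fun q : ℕ => (q : ℝ) ^ (n - 1) * ψ q ^ (n - 1)) :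
    ∑' v : Fin n → ℤ, padicHaar p n (padicCone p v (ψ (Hsup v))) ≠ ∞ := by
  have hbound (q : ℕ) : ∑' v : Hsup (n := n) ⁻¹' {q}, padicHaar p n (padicCone p v (ψ (Hsup v.1))) ≤
      (2 * n * 3 ^ (n - 1) : ℕ) * ENNReal.ofReal ((q : ℝ) ^ (n - 1) * ψ q ^ (n - 1)) := by
    rcases eq_or_ne q 0 with rfl | hq
    · refine le_of_eq_of_le (ENNReal.tsum_eq_zero.2 ?_) zero_le
      rintro ⟨v, hv⟩
      have hnp : ¬ IsPrim v := fun h => h.Hsup_ne_zero hv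
      simp [padicCone, hnp]
    calc ∑' v : Hsup (n := n) ⁻¹' {q}, padicHaar p n (padicCone p v (ψ (Hsup v.1)))
        ≤ ∑' _ : Hsup (n := n) ⁻¹' {q}, ENNReal.ofReal (ψ q ^ (n - 1)) := by
          refine ENNReal.tsum_le_tsum ?_
          rintro ⟨v, rfl⟩
          exact padicHaar_padicCone_le p v (hψ _)
      _ ≤ ((2 * n * 3 ^ (n - 1) * q ^ (n - 1) : ℕ) : ℝ≥0∞) * ENNReal.ofReal (ψ q ^ (n - 1)) := by
          rw [ENNReal.tsum_set_const]
          gcongr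
          exact encard_Hsup_fiber_le n q hq
      _ = _ := by
          rw [ENNReal.ofReal_mul (by positivity), Nat.cast_mul, mul_assoc,
            ← ENNReal.ofReal_natCast (q ^ (n - 1)), Nat.cast_pow q]
  rw [← ENNReal.tsum_fiberwise _ Hsup]
  refine ne_top_of_le_ne_top ?_ (ENNReal.tsum_le_tsum hbound)
  rw [ENNReal.tsum_mul_left]
  exact ENNReal.mul_ne_top (ENNReal.natCast_ne_top _) hconv.tsum_ofReal_ne_top

end ProjectiveConvergence

/-- convergence case (Borel–Cantelli): if `Σ q^{n-1} ψ(q)^{n-1} < ∞` then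
`μ_p(W_p(ψ, ℚ, n)) = 0`. -/
theorem projective_convergence (n p : ℕ) (hn : 2 ≤ n) [Fact p.Prime]
    (ψ : ℕ → ℝ) (hψ : ∀ q, 0 ≤ ψ q)
    (hconv : Summable fun q : ℕ => (q : ℝ) ^ (n - 1) * ψ q ^ (n - 1)) :
    muP p n (Wp p n ψ) = 0 := by
  refine measure_mono_null ?_ (measure_limsup_cofinite_eq_zero
    (tsum_padicHaar_padicCone_ne_top n p ψ hψ hconv))
  rintro x ⟨hx1, hx0, hx⟩
  rw [Filter.mem_limsup_iff_frequently_mem, Filter.frequently_cofinite_iff_infinite]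
  refine fun hfin => hx ?_
  refine ((hfin.image fun v => {y : Projectivization ℚ (Fin n → ℚ) |
    ∃ hv : intRat v ≠ 0, y = Projectivization.mk ℚ (intRat v) hv}).sUnion ?_).subset ?_
  · rintro _ ⟨v, -, rfl⟩
    refine Set.Subsingleton.finite ?_
    rintro _ ⟨_, rfl⟩ _ ⟨_, rfl⟩
    rfl
  · rintro y ⟨v, hv, hy, hd⟩
    rw [padicDelta_rep hx0] at hd
    exact ⟨_, ⟨v, ⟨hv, hx1, hx0, hd⟩, rfl⟩, hy⟩
end

section
/- Let p be a prime, let n > 2, and let ψ : ℕ → [0,∞) be any function (not assumed monotone) satisfying ψ(q) = 0 whenever p divides q. If the series Σ_{q=1}^∞ q^{n-1} ψ(q)^{n-1} diverges, then μ_p(W_p(ψ, ℚ, n)) = 1. -/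
open MeasureTheory

/-- The residue pairs `(a, b)` with `a / q ≡ b / q'` modulo `P`. -/
noncomputable def congruentPairs (q q' P : ℕ) : Finset (ℤ × ℤ) :=
  {ab ∈ Finset.Ico (0 : ℤ) q ×ˢ Finset.Ico (0 : ℤ) q' | (P : ℤ) ∣ q * ab.2 - q' * ab.1}

lemma card_fiber_congruentPairs_le {q q' : ℕ} (hq : 0 < q) (P : ℕ) (m : ℤ) :
    ({ab ∈ congruentPairs q q' P | (q : ℤ) * ab.2 - q' * ab.1 = m}).card ≤ q.gcd q' := by
  obtain ⟨h, h', hco, hh, hh'⟩ := Nat.exists_coprime q q'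
  have hg : 0 < q.gcd q' := Nat.gcd_pos_of_pos_left _ hq
  set g := q.gcd q' with hgdef
  have hhpos : 0 < h := Nat.pos_of_ne_zero (by rintro rfl; omega)
  have hq0 : (q : ℤ) ≠ 0 := by exact_mod_cast hq.ne'
  have hqz : (q : ℤ) = h * g := by exact_mod_cast hh
  have hqz' : (q' : ℤ) = h' * g := by exact_mod_cast hh'
  calc _ ≤ (Finset.Ico (0 : ℤ) g).card := by
        refine Finset.card_le_card_of_injOn (fun ab => ab.1 / h) ?_ ?_
        · rintro ⟨a, b⟩ hab
          simp only [congruentPairs, Finset.coe_filter, Finset.mem_filter, Finset.mem_product,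
            Finset.mem_Ico, Set.mem_ofPred_eq] at hab
          simp only [Finset.coe_Ico, Set.mem_Ico]
          refine ⟨Int.ediv_nonneg hab.1.1.1.1 (by positivity), ?_⟩
          rw [Int.ediv_lt_iff_lt_mul (by exact_mod_cast hhpos)]
          linarith [hab.1.1.1.2, mul_comm (h : ℤ) g]
        · rintro ⟨a, b⟩ hab ⟨a', b'⟩ hab' heq
          simp only [congruentPairs, Finset.coe_filter, Finset.mem_filter, Finset.mem_product,
            Finset.mem_Ico, Set.mem_ofPred_eq] at hab hab' heq
          have hdvd : (h : ℤ) ∣ a - a' := by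
            have h1 : (g : ℤ) * (h * (b - b')) = g * (h' * (a - a')) := by
              have := hab.2.trans hab'.2.symm
              rw [hqz, hqz'] at this
              linear_combination this
            have h2 := mul_left_cancel₀ (by exact_mod_cast hg.ne') h1
            exact IsCoprime.dvd_of_dvd_mul_left (Nat.isCoprime_iff_coprime.mpr hco)
              (h2 ▸ dvd_mul_right _ _)
          have hmod : a % h = a' % h :=
            Int.emod_eq_emod_iff_emod_sub_eq_zero.mpr (Int.emod_eq_zero_of_dvd hdvd)
          have ha : a = a' := by
            rw [← Int.mul_ediv_add_emod a h, ← Int.mul_ediv_add_emod a' h, heq, hmod]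
          subst ha
          have hb : b = b' := by
            refine mul_left_cancel₀ hq0 ?_
            linarith [hab.2, hab'.2]
          rw [hb]
    _ = g := by simp

lemma card_congruentPairs_mul_le {q q' P : ℕ} (hq : 0 < q) (hP : 0 < P) (hqP : q.Coprime P)
    (hg : q.gcd q' * P ≤ q * q') : (congruentPairs q q' P).card * P ≤ 3 * (q * q') := by
  have hgpos : 0 < q.gcd q' := Nat.gcd_pos_of_pos_left _ hq
  set g := q.gcd q' with hgdef
  have hgP : 0 < g * P := Nat.mul_pos hgpos hP
  set X := q * q' / (g * P) with hX
  have hX1 : 1 ≤ X := (Nat.one_le_div_iff hgP).mpr hg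
  have hXle : X * (g * P) ≤ q * q' := Nat.div_mul_le_self _ _
  have himage : ((congruentPairs q q' P).image
      fun ab => (q : ℤ) * ab.2 - q' * ab.1).card ≤ 2 * X + 1 := by
    have hgz : (0 : ℤ) < ((g * P : ℕ) : ℤ) := by exact_mod_cast hgP
    have hlt : (q : ℤ) * q' < ((X : ℤ) + 1) * ((g * P : ℕ) : ℤ) := by
      have : q * q' < (X + 1) * (g * P) := (Nat.div_lt_iff_lt_mul hgP).mp (Nat.lt_succ_self _)
      exact_mod_cast this
    have hval : ∀ m ∈ (congruentPairs q q' P).image fun ab => (q : ℤ) * ab.2 - q' * ab.1,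
        ∃ c : ℤ, m = ((g * P : ℕ) : ℤ) * c ∧ -(X : ℤ) ≤ c ∧ c ≤ X := by
      intro m hm
      simp only [Finset.mem_image] at hm
      obtain ⟨⟨a, b⟩, hab, rfl⟩ := hm
      simp only [congruentPairs, Finset.mem_filter, Finset.mem_product, Finset.mem_Ico] at hab
      obtain ⟨⟨⟨ha0, ha⟩, hb0, hb⟩, hPdvd⟩ := hab
      have hgdvd : (g : ℤ) ∣ q * b - q' * a :=
        dvd_sub (Dvd.dvd.mul_right (by exact_mod_cast Nat.gcd_dvd_left q q') _)
          (Dvd.dvd.mul_right (by exact_mod_cast Nat.gcd_dvd_right q q') _)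
      have hco : IsCoprime (g : ℤ) P :=
        Nat.isCoprime_iff_coprime.mpr (hqP.coprime_dvd_left (Nat.gcd_dvd_left q q'))
      obtain ⟨c, hc⟩ := hco.mul_dvd hgdvd hPdvd
      refine ⟨c, by simpa using hc, ?_, ?_⟩
      · by_contra! hcon
        push_cast at hlt hgz
        nlinarith
      · by_contra! hcon
        push_cast at hlt hgz
        nlinarith
    calc _ ≤ (Finset.Icc (-(X : ℤ)) X).card := by
          refine Finset.card_le_card_of_injOn (fun m => m / ((g * P : ℕ) : ℤ)) ?_ ?_
          · intro m hm
            obtain ⟨c, rfl, hc⟩ := hval m hm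
            simp only [Finset.coe_Icc, Set.mem_Icc]
            rwa [Int.mul_ediv_cancel_left _ hgz.ne']
          · intro m hm m' hm' heq
            obtain ⟨c, rfl, -⟩ := hval m hm
            obtain ⟨c', rfl, -⟩ := hval m' hm'
            simp only [Int.mul_ediv_cancel_left _ hgz.ne'] at heq
            rw [heq]
      _ = 2 * X + 1 := by simp; omega
  have hcard := Finset.card_le_mul_card_image (f := fun ab : ℤ × ℤ => (q : ℤ) * ab.2 - q' * ab.1)
    (congruentPairs q q' P) g (fun m _ => card_fiber_congruentPairs_le hq P m)
  calc (congruentPairs q q' P).card * P ≤ g * (2 * X + 1) * P := by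
        gcongr; exact hcard.trans (by gcongr)
    _ ≤ g * (3 * X) * P := by gcongr; omega
    _ = 3 * (X * (g * P)) := by ring
    _ ≤ _ := by gcongr

open Classical in
/-- The primitive integer vectors with `j`-th coordinate `q` and all others in `[0, q)`. -/
noncomputable def primVectors {n : ℕ} (j : Fin n) (q : ℕ) : Finset (Fin n → ℤ) :=
  {v ∈ Fintype.piFinset fun i => if i = j then {(q : ℤ)} else Finset.Ico (0 : ℤ) q | IsPrim v}

lemma mem_primVectors {n : ℕ} {j : Fin n} {q : ℕ} {v : Fin n → ℤ} :
    v ∈ primVectors j q ↔ v j = q ∧ (∀ i, i ≠ j → 0 ≤ v i ∧ v i < q) ∧ IsPrim v := by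
  simp only [primVectors, Finset.mem_filter, Fintype.mem_piFinset]
  refine ⟨fun ⟨h, hp⟩ => ⟨by simpa using h j, fun i hi => by simpa [hi] using h i, hp⟩,
    fun ⟨hj, h, hp⟩ => ⟨fun i => ?_, hp⟩⟩
  by_cases hi : i = j
  · subst hi; simpa using hj
  · simpa [hi] using h i hi

lemma card_piFinset_ite {n : ℕ} {α : Type*} (j : Fin n) (c : α) (s : Finset α) :
    (Fintype.piFinset fun i => if i = j then {c} else s).card = s.card ^ (n - 1) := by
  rw [Fintype.card_piFinset]
  simp only [apply_ite Finset.card, Finset.card_singleton]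
  rw [Finset.prod_ite]
  simp [Finset.filter_ne', Finset.card_erase_of_mem]

lemma card_primVectors_le {n : ℕ} (j : Fin n) (q : ℕ) : (primVectors j q).card ≤ q ^ (n - 1) := by
  classical
  refine (Finset.card_filter_le _ _).trans ?_
  rw [card_piFinset_ite]
  simp

lemma exists_mul_ne_mul_of_primVectors {n : ℕ} {j : Fin n} {q q' : ℕ} (hne : q ≠ q')
    {v v' : Fin n → ℤ} (hv : v ∈ primVectors j q) (hv' : v' ∈ primVectors j q') :
    ∃ i, i ≠ j ∧ (q : ℤ) * v' i ≠ q' * v i := by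
  rw [mem_primVectors] at hv hv'
  by_contra! h
  have hall : ∀ i, (q : ℤ) * v' i = q' * v i := by
    intro i
    by_cases hi : i = j
    · subst hi; rw [hv.1, hv'.1, mul_comm]
    · exact h i hi
  have := congrArg (fun f : Fin n → ℤ => Finset.univ.gcd f) (funext hall)
  simp only [Finset.gcd_mul_left] at this
  rw [show Finset.univ.gcd v' = 1 from hv'.2.2, show Finset.univ.gcd v = 1 from hv.2.2] at this
  simp only [mul_one, ← Int.abs_eq_normalize, Nat.abs_cast] at this
  exact hne (by exact_mod_cast this)

/-- The pairs of primitive vectors whose directions agree modulo `P`. -/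
noncomputable def closePairs {n : ℕ} (j : Fin n) (q q' P : ℕ) :
    Finset ((Fin n → ℤ) × (Fin n → ℤ)) :=
  {vv ∈ primVectors j q ×ˢ primVectors j q' |
    ∀ i, i ≠ j → (P : ℤ) ∣ q * vv.2 i - q' * vv.1 i}

lemma card_closePairs_mul_le {n : ℕ} (j : Fin n) {q q' P : ℕ} (hq : 0 < q) (hP : 0 < P)
    (hqP : q.Coprime P) (hne : q ≠ q') :
    (closePairs j q q' P).card * P ^ (n - 1) ≤ (3 * (q * q')) ^ (n - 1) := by
  rcases (closePairs j q q' P).eq_empty_or_nonempty with hemp | ⟨⟨v, v'⟩, hvv⟩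
  · simp [hemp]
  simp only [closePairs, Finset.mem_filter, Finset.mem_product] at hvv
  obtain ⟨⟨hv, hv'⟩, hdvd⟩ := hvv
  obtain ⟨i, hij, hi⟩ := exists_mul_ne_mul_of_primVectors hne hv hv'
  have hg : q.gcd q' * P ≤ q * q' := by
    have hgdvd : ((q.gcd q' : ℕ) : ℤ) ∣ q * v' i - q' * v i :=
      dvd_sub (Dvd.dvd.mul_right (by exact_mod_cast Nat.gcd_dvd_left q q') _)
        (Dvd.dvd.mul_right (by exact_mod_cast Nat.gcd_dvd_right q q') _)
    have hco : IsCoprime ((q.gcd q' : ℕ) : ℤ) P :=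
      Nat.isCoprime_iff_coprime.mpr (hqP.coprime_dvd_left (Nat.gcd_dvd_left q q'))
    have hle := Int.le_of_dvd (abs_pos.mpr (sub_ne_zero.mpr hi))
      ((dvd_abs _ _).mpr (hco.mul_dvd hgdvd (hdvd i hij)))
    have h1 := (mem_primVectors.mp hv).2.1 i hij
    have h2 := (mem_primVectors.mp hv').2.1 i hij
    have habs : |(q : ℤ) * v' i - q' * v i| ≤ q * q' := by
      rw [abs_le]
      constructor <;> nlinarith
    exact_mod_cast hle.trans habs
  have hcard : (closePairs j q q' P).card ≤ (congruentPairs q q' P).card ^ (n - 1) := by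
    rw [← card_piFinset_ite j ((q : ℤ), (q' : ℤ))]
    refine Finset.card_le_card_of_injOn (fun vv i => (vv.1 i, vv.2 i)) ?_ ?_
    · rintro ⟨w, w'⟩ hw
      simp only [closePairs, Finset.coe_filter, Finset.mem_product, Set.mem_ofPred_eq] at hw
      rw [mem_primVectors, mem_primVectors] at hw
      rw [Finset.mem_coe, Fintype.mem_piFinset]
      intro i
      by_cases hi : i = j
      · subst hi; simp [hw.1.1.1, hw.1.2.1]
      · simp only [hi, if_false, congruentPairs, Finset.mem_filter, Finset.mem_product,
          Finset.mem_Ico]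
        exact ⟨⟨hw.1.1.2.1 i hi, hw.1.2.2.1 i hi⟩, hw.2 i hi⟩
    · rintro ⟨w, w'⟩ - ⟨u, u'⟩ - h
      have h' := fun i => Prod.ext_iff.mp (congrFun h i)
      exact Prod.ext (funext fun i => (h' i).1) (funext fun i => (h' i).2)
  calc _ ≤ (congruentPairs q q' P).card ^ (n - 1) * P ^ (n - 1) := by gcongr
    _ = ((congruentPairs q q' P).card * P) ^ (n - 1) := (mul_pow _ _ _).symm
    _ ≤ _ := Nat.pow_le_pow_left (card_congruentPairs_mul_le hq hP hqP hg) _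

lemma sum_primeFactors_inv_sq_le (q : ℕ) : ∑ l ∈ q.primeFactors, ((l : ℝ) ^ 2)⁻¹ ≤ 3 / 4 := by
  have hsub : q.primeFactors ⊆ insert 2 (Finset.Ioc 2 (q + 2)) := by
    intro l hl
    have h1 := (Nat.prime_of_mem_primeFactors hl).two_le
    have h2 := Nat.le_of_mem_primeFactors hl
    simp only [Finset.mem_insert, Finset.mem_Ioc]
    omega
  calc _ ≤ ∑ l ∈ insert 2 (Finset.Ioc 2 (q + 2)), ((l : ℝ) ^ 2)⁻¹ :=
        Finset.sum_le_sum_of_subset_of_nonneg hsub fun _ _ _ => by positivity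
    _ = ((2 : ℕ) ^ 2 : ℝ)⁻¹ + ∑ l ∈ Finset.Ioc 2 (q + 2), ((l : ℝ) ^ 2)⁻¹ := by
        rw [Finset.sum_insert (by simp)]
    _ ≤ ((2 : ℕ) ^ 2 : ℝ)⁻¹ + ((2 : ℕ) : ℝ)⁻¹ := by
        gcongr
        refine (sum_Ioc_inv_sq_le_sub two_ne_zero (by omega)).trans ?_
        simp only [tsub_le_iff_right, le_add_iff_nonneg_right]
        positivity
    _ = 3 / 4 := by norm_num

lemma card_Ico_dvd {q l : ℕ} (hl : 0 < l) (hlq : l ∣ q) :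
    ({a ∈ Finset.Ico (0 : ℤ) q | (l : ℤ) ∣ a}).card = q / l := by
  obtain ⟨c, rfl⟩ := hlq
  have : {a ∈ Finset.Ico (0 : ℤ) (l * c : ℕ) | (l : ℤ) ∣ a} =
      (Finset.Ico (0 : ℤ) c).image fun b => (l : ℤ) * b := by
    ext a
    simp only [Finset.mem_filter, Finset.mem_Ico, Finset.mem_image]
    have hl' : (0 : ℤ) < l := by exact_mod_cast hl
    constructor
    · rintro ⟨⟨h0, h1⟩, b, rfl⟩
      push_cast at h1
      exact ⟨b, ⟨nonneg_of_mul_nonneg_right h0 hl', lt_of_mul_lt_mul_left h1 hl'.le⟩, rfl⟩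
    · rintro ⟨b, ⟨h0, h1⟩, rfl⟩
      push_cast
      exact ⟨⟨by positivity, by gcongr⟩, dvd_mul_right _ _⟩
  rw [this, Finset.card_image_of_injective _
    (mul_right_injective₀ (by exact_mod_cast hl.ne')), Nat.mul_div_cancel_left _ hl]
  simp

lemma pow_le_four_mul_card_primVectors {n : ℕ} (hn : 2 < n) (j : Fin n) {q : ℕ} (hq : 0 < q) :
    (q : ℝ) ^ (n - 1) ≤ 4 * (primVectors j q).card := by
  classical
  set box := Fintype.piFinset fun i => if i = j then {(q : ℤ)} else Finset.Ico (0 : ℤ) q with hbox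
  have hboxcard : box.card = q ^ (n - 1) := by rw [hbox, card_piFinset_ite]; simp
  set bad := fun l : ℕ => Fintype.piFinset fun i =>
    if i = j then {(q : ℤ)} else {a ∈ Finset.Ico (0 : ℤ) q | (l : ℤ) ∣ a} with hbad
  have hsub : box ⊆ primVectors j q ∪ q.primeFactors.biUnion bad := by
    intro v hv
    rw [Finset.mem_union, or_iff_not_imp_left]
    intro hnot
    have hnp : ¬ IsPrim v := fun h => hnot (Finset.mem_filter.mpr ⟨hv, h⟩)
    have hvj : v j = q := by simpa [hbox] using (Fintype.mem_piFinset.mp hv) j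
    have hunit : (Finset.univ.gcd v).natAbs ≠ 1 := by
      intro h
      apply hnp
      rw [IsPrim, ← Finset.normalize_gcd, ← Int.abs_eq_normalize, Int.abs_eq_natAbs, h]
      rfl
    obtain ⟨l, hl, hldvd⟩ := Nat.exists_prime_and_dvd hunit
    have hlv : ∀ i, (l : ℤ) ∣ v i := fun i =>
      (Int.natCast_dvd.mpr hldvd).trans (Finset.gcd_dvd (Finset.mem_univ i))
    rw [Finset.mem_biUnion]
    refine ⟨l, Nat.mem_primeFactors.mpr ⟨hl, by exact_mod_cast hvj ▸ hlv j, hq.ne'⟩, ?_⟩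
    rw [Fintype.mem_piFinset]
    intro i
    have hi' := (Fintype.mem_piFinset.mp hv) i
    by_cases hi : i = j
    · simpa [hi] using hvj
    · simp only [hi, if_false] at hi' ⊢
      exact Finset.mem_filter.mpr ⟨hi', hlv i⟩
  have hbadcard : ∀ l ∈ q.primeFactors,
      ((bad l).card : ℝ) ≤ (q : ℝ) ^ (n - 1) * ((l : ℝ) ^ 2)⁻¹ := by
    intro l hl
    have hlpos := (Nat.prime_of_mem_primeFactors hl).pos
    have hl1 : (1 : ℝ) ≤ l := by exact_mod_cast hlpos
    rw [hbad, card_piFinset_ite, card_Ico_dvd hlpos (Nat.dvd_of_mem_primeFactors hl)]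
    push_cast
    rw [Nat.cast_div (Nat.dvd_of_mem_primeFactors hl) (by positivity), div_pow, div_eq_mul_inv]
    gcongr
    omega
  have h1 : (q : ℝ) ^ (n - 1) ≤ (primVectors j q).card + ∑ l ∈ q.primeFactors, ((bad l).card : ℝ) := by
    have := (Finset.card_le_card hsub).trans ((Finset.card_union_le _ _).trans
      (Nat.add_le_add_left Finset.card_biUnion_le _))
    rw [hboxcard] at this
    exact_mod_cast this
  have h2 : ∑ l ∈ q.primeFactors, ((bad l).card : ℝ) ≤ (q : ℝ) ^ (n - 1) * (3 / 4) := by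
    refine (Finset.sum_le_sum hbadcard).trans ?_
    rw [← Finset.mul_sum]
    gcongr
    exact sum_primeFactors_inv_sq_le q
  linarith

/-- Representatives of the residue classes modulo `p ^ k` of the coordinates other than `j`. -/
def residueVectors {n : ℕ} (p : ℕ) (j : Fin n) (k : ℕ) : Finset (Fin n → ℕ) :=
  Fintype.piFinset fun i => if i = j then {0} else Finset.range (p ^ k)

lemma card_residueVectors {n : ℕ} (p : ℕ) (j : Fin n) (k : ℕ) :
    (residueVectors p j k).card = (p ^ k) ^ (n - 1) := by
  rw [residueVectors, card_piFinset_ite, Finset.card_range]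

section ChungErdos

variable {Ω ι : Type*} [MeasurableSpace Ω]

/-- The Chung–Erdős inequality. -/
lemma sq_sum_measureReal_le (μ : Measure Ω) [IsFiniteMeasure μ] (s : Finset ι) {D : ι → Set Ω}
    (hD : ∀ i, MeasurableSet (D i)) :
    (∑ i ∈ s, μ.real (D i)) ^ 2 ≤
      μ.real (⋃ i ∈ s, D i) * ∑ i ∈ s, ∑ j ∈ s, μ.real (D i ∩ D j) := by
  set U := ⋃ i ∈ s, D i with hU
  have hUm : MeasurableSet U := Finset.measurableSet_biUnion _ fun i _ => hD i
  have hint : ∀ A : Set Ω, MeasurableSet A → Integrable (A.indicator fun _ => (1 : ℝ)) μ :=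
    fun A hA => (integrable_const _).indicator hA
  have hintegral : ∀ A : Set Ω, MeasurableSet A →
      ∫ x, A.indicator (fun _ => (1 : ℝ)) x ∂μ = μ.real A := fun A hA => by
    rw [integral_indicator_const _ hA]; simp
  have hquad : ∀ t : ℝ, 0 ≤ (∑ i ∈ s, ∑ j ∈ s, μ.real (D i ∩ D j)) * (t * t)
      + (-2 * ∑ i ∈ s, μ.real (D i)) * t + μ.real U := by
    intro t
    have hnn : 0 ≤ ∫ x, ((t * t) * (∑ i ∈ s, ∑ j ∈ s, (D i ∩ D j).indicator (fun _ => (1 : ℝ)) x)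
        + (-2 * t) * (∑ i ∈ s, (D i).indicator (fun _ => (1 : ℝ)) x)
        + U.indicator (fun _ => (1 : ℝ)) x) ∂μ := by
      refine integral_nonneg fun x => ?_
      have h1 : ∑ i ∈ s, ∑ j ∈ s, (D i ∩ D j).indicator (fun _ => (1 : ℝ)) x =
          (∑ i ∈ s, (D i).indicator (fun _ => (1 : ℝ)) x) ^ 2 := by
        rw [sq, Finset.sum_mul_sum]
        refine Finset.sum_congr rfl fun i _ => Finset.sum_congr rfl fun j _ => ?_
        rw [← Set.inter_indicator_mul]
        simp
      simp only [Pi.zero_apply, h1]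
      by_cases hx : x ∈ U
      · rw [Set.indicator_of_mem hx]
        nlinarith [sq_nonneg (t * (∑ i ∈ s, (D i).indicator (fun _ => (1 : ℝ)) x) - 1)]
      · have : ∑ i ∈ s, (D i).indicator (fun _ => (1 : ℝ)) x = 0 := by
          refine Finset.sum_eq_zero fun i hi => Set.indicator_of_notMem (fun hxi => hx ?_) _
          exact Set.mem_biUnion (by exact hi) hxi
        rw [this, Set.indicator_of_notMem hx]
        simp
    have hi2 : Integrable (fun x => ∑ i ∈ s, ∑ j ∈ s,
        (D i ∩ D j).indicator (fun _ => (1 : ℝ)) x) μ :=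
      integrable_finsetSum _ fun i _ => integrable_finsetSum _ fun j _ =>
        hint _ ((hD i).inter (hD j))
    have hi1 : Integrable (fun x => ∑ i ∈ s, (D i).indicator (fun _ => (1 : ℝ)) x) μ :=
      integrable_finsetSum _ fun i _ => hint _ (hD i)
    have hi12 : Integrable (fun x =>
        (t * t) * (∑ i ∈ s, ∑ j ∈ s, (D i ∩ D j).indicator (fun _ => (1 : ℝ)) x)
        + (-2 * t) * (∑ i ∈ s, (D i).indicator (fun _ => (1 : ℝ)) x)) μ :=
      (hi2.const_mul _).add (hi1.const_mul _)
    rw [integral_add hi12 (hint _ hUm), integral_add (hi2.const_mul _) (hi1.const_mul _),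
      integral_const_mul, integral_const_mul,
      integral_finsetSum _ fun i _ => integrable_finsetSum _ fun j _ =>
        hint _ ((hD i).inter (hD j)),
      integral_finsetSum _ fun i _ => hint _ (hD i), hintegral _ hUm] at hnn
    simp_rw [hintegral _ (hD _)] at hnn
    have h2 : ∀ i ∈ s, ∫ x, ∑ j ∈ s, (D i ∩ D j).indicator (fun _ => (1 : ℝ)) x ∂μ =
        ∑ j ∈ s, μ.real (D i ∩ D j) := fun i _ => by
      rw [integral_finsetSum _ fun j _ => hint _ ((hD i).inter (hD j))]
      exact Finset.sum_congr rfl fun j _ => hintegral _ ((hD i).inter (hD j))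
    rw [Finset.sum_congr rfl h2] at hnn
    linarith
  have := discrim_le_zero hquad
  rw [discrim] at this
  linarith

end ChungErdos

section Slow

open Filter

lemma exists_tendsto_not_summable_div_pow {a : ℕ → ℝ} (ha : ∀ q, 0 ≤ a q) (hdiv : ¬ Summable a)
    {b : ℕ} (hb : 1 < b) :
    ∃ e : ℕ → ℕ, Tendsto e atTop atTop ∧ ¬ Summable fun q => a q / (b : ℝ) ^ e q := by
  have htend := (not_summable_iff_tendsto_nat_atTop_of_nonneg ha).mp hdiv
  set s : ℕ → ℝ := fun N => ∑ q ∈ Finset.range N, a q with hs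
  have hs0 : ∀ N, 0 ≤ s N := fun N => Finset.sum_nonneg fun q _ => ha q
  have hsmono : Monotone s := fun M N h =>
    Finset.sum_le_sum_of_subset_of_nonneg (Finset.range_mono h) fun q _ _ => ha q
  refine ⟨fun q => Nat.log b ⌊1 + s q⌋₊, ?_, fun hsum => ?_⟩
  · have hlog : Tendsto (Nat.log b) atTop atTop :=
      tendsto_atTop_atTop_of_monotone (fun _ _ h => Nat.log_mono_right h)
        fun k => ⟨b ^ k, by rw [Nat.log_pow hb]⟩
    exact hlog.comp (tendsto_nat_floor_atTop.comp (tendsto_atTop_add_const_left _ _ htend))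
  · have hpow : ∀ q, (b : ℝ) ^ Nat.log b ⌊1 + s q⌋₊ ≤ 1 + s q := fun q => by
      have h1 : ⌊1 + s q⌋₊ ≠ 0 := by
        have : 1 ≤ ⌊1 + s q⌋₊ := Nat.le_floor (by simpa using hs0 q)
        omega
      calc (b : ℝ) ^ Nat.log b ⌊1 + s q⌋₊ ≤ (⌊1 + s q⌋₊ : ℝ) := by
            exact_mod_cast Nat.pow_log_le_self b h1
        _ ≤ _ := Nat.floor_le (by linarith [hs0 q])
    have hf0 : ∀ q, 0 ≤ a q / (b : ℝ) ^ Nat.log b ⌊1 + s q⌋₊ := fun q =>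
      div_nonneg (ha q) (by positivity)
    obtain ⟨Q, hQ⟩ := ((tendsto_sum_nat_add
      fun q => a q / (b : ℝ) ^ Nat.log b ⌊1 + s q⌋₊).eventually_lt_const
        (show (0 : ℝ) < 1 / 2 by norm_num)).exists
    obtain ⟨N, hNQ, hN⟩ := ((eventually_ge_atTop Q).and
      (htend.eventually_ge_atTop (2 + 2 * s Q))).exists
    have hle : ∑ q ∈ Finset.range (N - Q), a (q + Q) / (1 + s N) ≤ 1 / 2 := by
      refine le_trans ?_ hQ.le
      refine le_trans (Finset.sum_le_sum fun q hq => ?_)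
        (((summable_nat_add_iff Q).mpr hsum).sum_le_tsum (Finset.range (N - Q))
          fun q _ => hf0 (q + Q))
      have hqN : q + Q ≤ N := by have := Finset.mem_range.mp hq; omega
      have : (0 : ℝ) < (b : ℝ) ^ Nat.log b ⌊1 + s (q + Q)⌋₊ := by positivity
      exact div_le_div_of_nonneg_left (ha _) this ((hpow _).trans (by gcongr; exact hsmono hqN))
    rw [← Finset.sum_div, div_le_iff₀ (by linarith [hs0 N])] at hle
    have hsplit : s N = s Q + ∑ q ∈ Finset.range (N - Q), a (q + Q) := by
      rw [hs]
      simp only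
      rw [← Finset.sum_range_add_sum_Ico _ hNQ, Finset.sum_Ico_eq_sum_range]
      simp only [add_comm]
    change 2 + 2 * s Q ≤ s N at hN
    linarith [hs0 N]

end Slow

section Cones

variable {p : ℕ} [Fact p.Prime] {n : ℕ}

/-- The integral vectors whose `j`-th coordinate is nonzero and of maximal absolute value. -/
def chart (p : ℕ) [Fact p.Prime] {n : ℕ} (j : Fin n) : Set (Fin n → ℚ_[p]) :=
  {x | x j ≠ 0 ∧ ‖x j‖ ≤ 1 ∧ ∀ i, ‖x i‖ ≤ ‖x j‖}

/-- The cone over the ball of radius `p ^ (-k)` centered at `w` in the `j`-th affine chart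
(the coordinate `w j` is irrelevant). -/
def cone (j : Fin n) (w : Fin n → ℚ_[p]) (k : ℕ) : Set (Fin n → ℚ_[p]) :=
  {x | x ∈ chart p j ∧ ∀ i, i ≠ j → ‖x i - w i * x j‖ ≤ (p : ℝ) ^ (-(k : ℤ)) * ‖x j‖}

lemma cone_subset_chart (j : Fin n) (w : Fin n → ℚ_[p]) (k : ℕ) : cone j w k ⊆ chart p j :=
  fun _ hx => hx.1

lemma measurableSet_chart (j : Fin n) : MeasurableSet (chart p j) := by
  have h0 : IsOpen {x : Fin n → ℚ_[p] | x j ≠ 0} :=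
    isOpen_ne_fun (continuous_apply j) continuous_const
  have h1 : IsClosed {x : Fin n → ℚ_[p] | ‖x j‖ ≤ 1 ∧ ∀ i, ‖x i‖ ≤ ‖x j‖} := by
    simp only [Set.ofPred_and, Set.ofPred_forall]
    exact (isClosed_le (by fun_prop) (by fun_prop)).inter
      (isClosed_iInter fun i => isClosed_le (by fun_prop) (by fun_prop))
  exact h0.measurableSet.inter h1.measurableSet

lemma measurableSet_cone (j : Fin n) (w : Fin n → ℚ_[p]) (k : ℕ) :
    MeasurableSet (cone j w k) := by
  have h1 : IsClosed {x : Fin n → ℚ_[p] |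
      ∀ i, i ≠ j → ‖x i - w i * x j‖ ≤ (p : ℝ) ^ (-(k : ℤ)) * ‖x j‖} := by
    simp only [Set.ofPred_forall]
    exact isClosed_iInter fun i => isClosed_iInter fun _ =>
      isClosed_le (by fun_prop) (by fun_prop)
  exact (measurableSet_chart j).inter h1.measurableSet

lemma zpow_neg_le_zpow_neg (p : ℕ) [Fact p.Prime] {k l : ℕ} (h : k ≤ l) :
    (p : ℝ) ^ (-(l : ℤ)) ≤ (p : ℝ) ^ (-(k : ℤ)) :=
  zpow_le_zpow_right₀ (by exact_mod_cast (Fact.out : p.Prime).one_le) (by omega)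

lemma norm_sub_le_of_mem_cone {j : Fin n} {w w' : Fin n → ℚ_[p]} {k k' : ℕ} {x : Fin n → ℚ_[p]}
    (hx : x ∈ cone j w k) (hx' : x ∈ cone j w' k') {i : Fin n} (hi : i ≠ j) :
    ‖w i - w' i‖ ≤ (p : ℝ) ^ (-((min k k' : ℕ) : ℤ)) := by
  have hpos : 0 < ‖x j‖ := norm_pos_iff.mpr hx.1.1
  refine le_of_mul_le_mul_right ?_ hpos
  rw [← norm_mul, show (w i - w' i) * x j = (x i - w' i * x j) - (x i - w i * x j) by ring]
  rw [sub_eq_add_neg]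
  refine (IsUltrametricDist.norm_add_le_max _ _).trans (max_le ?_ ?_)
  · exact (hx'.2 i hi).trans
      (mul_le_mul_of_nonneg_right (zpow_neg_le_zpow_neg p (min_le_right _ _)) hpos.le)
  · rw [norm_neg]
    exact (hx.2 i hi).trans
      (mul_le_mul_of_nonneg_right (zpow_neg_le_zpow_neg p (min_le_left _ _)) hpos.le)

lemma cone_subset_cone {j : Fin n} {w w' : Fin n → ℚ_[p]} {k k' : ℕ} (hk : k' ≤ k)
    (h : ∀ i, i ≠ j → ‖w i - w' i‖ ≤ (p : ℝ) ^ (-(k' : ℤ))) : cone j w k ⊆ cone j w' k' := by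
  refine fun x hx => ⟨hx.1, fun i hi => ?_⟩
  rw [show x i - w' i * x j = (x i - w i * x j) + (w i - w' i) * x j by ring]
  refine (IsUltrametricDist.norm_add_le_max _ _).trans (max_le ?_ ?_)
  · exact (hx.2 i hi).trans
      (mul_le_mul_of_nonneg_right (zpow_neg_le_zpow_neg p hk) (norm_nonneg _))
  · rw [norm_mul]; gcongr; exact h i hi

lemma cone_subset_or_disjoint {j : Fin n} {w w' : Fin n → ℚ_[p]} {k k' : ℕ} (hk : k' ≤ k) :
    cone j w k ⊆ cone j w' k' ∨ Disjoint (cone j w k) (cone j w' k') := by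
  rw [or_iff_not_imp_right, Set.not_disjoint_iff]
  rintro ⟨x, hx, hx'⟩
  refine cone_subset_cone hk fun i hi => ?_
  simpa [min_eq_right hk] using norm_sub_le_of_mem_cone hx hx' hi

/-- The linear automorphism fixing the `j`-th coordinate which, in the `j`-th affine chart,
is `z ↦ s (z + c)`. -/
noncomputable def chartMap (j : Fin n) (c : Fin n → ℚ_[p]) (s : ℚ_[p]) (hs : s ≠ 0) :
    (Fin n → ℚ_[p]) ≃L[ℚ_[p]] (Fin n → ℚ_[p]) :=
  LinearEquiv.toContinuousLinearEquiv
    { toFun := fun x i => if i = j then x j else s * (x i + c i * x j)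
      invFun := fun y i => if i = j then y j else s⁻¹ * y i - c i * y j
      map_add' := fun x y => by ext i; by_cases hi : i = j <;> simp [hi]; ring
      map_smul' := fun a x => by ext i; by_cases hi : i = j <;> simp [hi]; ring
      left_inv := fun x => by ext i; by_cases hi : i = j <;> simp [hi, hs]
      right_inv := fun x => by ext i; by_cases hi : i = j <;> simp [hi, hs] }

lemma chartMap_apply (j : Fin n) (c : Fin n → ℚ_[p]) (s : ℚ_[p]) (hs : s ≠ 0)
    (x : Fin n → ℚ_[p]) (i : Fin n) :
    chartMap j c s hs x i = if i = j then x j else s * (x i + c i * x j) := rfl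

lemma preimage_chartMap_chart (j : Fin n) {c : Fin n → ℚ_[p]} (hc : ∀ i, i ≠ j → ‖c i‖ ≤ 1)
    {s : ℚ_[p]} (hs : s ≠ 0) {m : ℕ} (hsm : ‖s‖ = (p : ℝ) ^ (m : ℤ)) :
    chartMap j c s hs ⁻¹' chart p j = cone j (-c) m := by
  have hp : (0 : ℝ) < p := by exact_mod_cast (Fact.out : p.Prime).pos
  have key : ∀ (x : Fin n → ℚ_[p]) i, ‖s * (x i + c i * x j)‖ ≤ ‖x j‖ ↔
      ‖x i - (-c) i * x j‖ ≤ (p : ℝ) ^ (-(m : ℤ)) * ‖x j‖ := fun x i => by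
    rw [norm_mul, hsm, Pi.neg_apply, neg_mul, sub_neg_eq_add, zpow_neg, ← div_eq_inv_mul,
      le_div_iff₀ (by positivity), mul_comm]
  ext x
  simp only [chart, cone, Set.mem_preimage, Set.mem_ofPred_eq, chartMap_apply, if_true]
  constructor
  · rintro ⟨h0, h1, h⟩
    have hcone : ∀ i, i ≠ j → ‖x i - (-c) i * x j‖ ≤ (p : ℝ) ^ (-(m : ℤ)) * ‖x j‖ := fun i hi =>
      (key x i).mp (by simpa [hi] using h i)
    refine ⟨⟨h0, h1, fun i => ?_⟩, hcone⟩
    by_cases hi : i = j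
    · rw [hi]
    · rw [show x i = (x i - (-c) i * x j) + -c i * x j by simp]
      refine (IsUltrametricDist.norm_add_le_max _ _).trans (max_le ((hcone i hi).trans ?_) ?_)
      · exact mul_le_of_le_one_left (norm_nonneg _)
          (by simpa using zpow_neg_le_zpow_neg p (Nat.zero_le m))
      · rw [norm_mul, norm_neg]
        exact mul_le_of_le_one_left (norm_nonneg _) (hc i hi)
  · rintro ⟨⟨h0, h1, -⟩, h⟩
    refine ⟨h0, h1, fun i => ?_⟩
    by_cases hi : i = j
    · simp [hi]
    · simpa [hi] using (key x i).mpr (h i hi)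

lemma cone_zero_right (j : Fin n) {w : Fin n → ℚ_[p]} (hw : ∀ i, i ≠ j → ‖w i‖ ≤ 1) :
    cone j w 0 = chart p j := by
  refine (cone_subset_chart j w 0).antisymm fun x hx => ⟨hx, fun i hi => ?_⟩
  rw [sub_eq_add_neg]
  refine (IsUltrametricDist.norm_add_le_max _ _).trans (max_le (by simpa using hx.2.2 i) ?_)
  rw [norm_neg, norm_mul]
  simpa using mul_le_of_le_one_left (norm_nonneg _) (hw i hi)

instance : (padicHaar p n).IsAddHaarMeasure := by unfold padicHaar; infer_instance

lemma padicHaar_unitBall : padicHaar p n {x | ∀ i, ‖x i‖ ≤ 1} = 1 :=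
  Measure.addHaarMeasure_self (K₀ := padicUnitPC p n)

lemma chart_subset_unitBall (j : Fin n) : chart p j ⊆ {x | ∀ i, ‖x i‖ ≤ 1} :=
  fun _ hx i => (hx.2.2 i).trans hx.2.1

/-- Haar measure restricted to the `j`-th chart. -/
noncomputable def chartMeasure (p : ℕ) [Fact p.Prime] {n : ℕ} (j : Fin n) :
    Measure (Fin n → ℚ_[p]) := (padicHaar p n).restrict (chart p j)

instance (j : Fin n) : IsFiniteMeasure (chartMeasure p j) := by
  refine isFiniteMeasure_restrict.mpr (ne_top_of_le_ne_top ENNReal.one_ne_top ?_)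
  exact (measure_mono (chart_subset_unitBall j)).trans padicHaar_unitBall.le

lemma chartMeasure_real_of_subset {j : Fin n} {A : Set (Fin n → ℚ_[p])} (hA : A ⊆ chart p j) :
    (chartMeasure p j).real A = (padicHaar p n).real A := by
  rw [chartMeasure, measureReal_restrict_apply' (measurableSet_chart j),
    Set.inter_eq_left.mpr hA]

lemma chartMeasure_real_univ (j : Fin n) :
    (chartMeasure p j).real Set.univ = (padicHaar p n).real (chart p j) := by
  rw [chartMeasure, measureReal_restrict_apply' (measurableSet_chart j), Set.univ_inter]

lemma chartMeasure_real_preimage_mul (j : Fin n) {c : Fin n → ℚ_[p]}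
    (hc : ∀ i, i ≠ j → ‖c i‖ ≤ 1) {s : ℚ_[p]} (hs : s ≠ 0) {m : ℕ}
    (hsm : ‖s‖ = (p : ℝ) ^ (m : ℤ)) {A : Set (Fin n → ℚ_[p])} (hA : MeasurableSet A)
    (hAc : A ⊆ chart p j) :
    (chartMeasure p j).real (chartMap j c s hs ⁻¹' A) * (chartMeasure p j).real Set.univ =
      (chartMeasure p j).real A * (chartMeasure p j).real (cone j (-c) m) := by
  have hpre := preimage_chartMap_chart j hc hs hsm
  have hsub : chartMap j c s hs ⁻¹' A ⊆ chart p j :=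
    (Set.preimage_mono hAc).trans (hpre ▸ cone_subset_chart _ _ _)
  have hmap := Measure.isAddLeftInvariant_eq_smul
    ((padicHaar p n).map (chartMap j c s hs)) (padicHaar p n)
  have hmeas : ∀ B, MeasurableSet B → (padicHaar p n).real (chartMap j c s hs ⁻¹' B) =
      (Measure.addHaarScalarFactor ((padicHaar p n).map (chartMap j c s hs)) (padicHaar p n)) *
        (padicHaar p n).real B := fun B hB => by
    rw [← map_measureReal_apply (chartMap j c s hs).continuous.measurable hB]
    conv_lhs => rw [hmap]
    rw [measureReal_nnreal_smul_apply]
  rw [chartMeasure_real_of_subset hsub, chartMeasure_real_of_subset hAc, chartMeasure_real_univ,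
    chartMeasure_real_of_subset (cone_subset_chart _ _ _), ← hpre, hmeas _ hA,
    hmeas _ (measurableSet_chart j)]
  ring

/-- The cone of level `k` centered at minus the integer vector `t`. -/
def residueCone (p : ℕ) [Fact p.Prime] {n : ℕ} (j : Fin n) (k : ℕ) (t : Fin n → ℕ) :
    Set (Fin n → ℚ_[p]) := cone j (-fun i => (t i : ℚ_[p])) k

lemma measurableSet_residueCone (j : Fin n) (k : ℕ) (t : Fin n → ℕ) :
    MeasurableSet (residueCone p j k t) := measurableSet_cone _ _ _

lemma norm_neg_natCast_le_one (t : Fin n → ℕ) (i : Fin n) :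
    ‖(-fun i => (t i : ℚ_[p])) i‖ ≤ 1 := by
  simpa using Padic.norm_int_le_one (p := p) (t i)

lemma exists_mem_residueCone {j : Fin n} {x : Fin n → ℚ_[p]} (hx : x ∈ chart p j) (k : ℕ) :
    ∃ t ∈ residueVectors p j k, x ∈ residueCone p j k t := by
  obtain ⟨h0, -, h⟩ := id hx
  have hpos : 0 < ‖x j‖ := norm_pos_iff.mpr h0
  let z : Fin n → ℤ_[p] := fun i => ⟨-(x i / x j), by
    rw [norm_neg, norm_div]; exact div_le_one_of_le₀ (h i) hpos.le⟩
  refine ⟨fun i => if i = j then 0 else (z i).appr k, ?_, hx, fun i hi => ?_⟩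
  · refine Fintype.mem_piFinset.mpr fun i => ?_
    by_cases hi : i = j
    · simp [hi]
    · simpa [hi] using PadicInt.appr_lt (z i) k
  · have hz : ‖z i - ((z i).appr k : ℤ_[p])‖ ≤ (p : ℝ) ^ (-(k : ℤ)) :=
      (PadicInt.norm_le_pow_iff_mem_span_pow _ _).mpr (PadicInt.appr_spec k (z i))
    have hcast : ((z i - ((z i).appr k : ℤ_[p]) : ℤ_[p]) : ℚ_[p]) =
        -(x i / x j) - ((z i).appr k : ℚ_[p]) := by
      rw [PadicInt.coe_sub, PadicInt.coe_natCast]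
    rw [PadicInt.norm_def, hcast] at hz
    have hid : x i - (-fun i => (((if i = j then 0 else (z i).appr k : ℕ)) : ℚ_[p])) i * x j =
        -(-(x i / x j) - ((z i).appr k : ℚ_[p])) * x j := by
      simp only [Pi.neg_apply, hi, if_false]; field_simp; ring
    rw [hid, norm_mul, norm_neg]
    exact mul_le_mul_of_nonneg_right hz hpos.le

lemma pairwiseDisjoint_residueCone (j : Fin n) (k : ℕ) :
    (residueVectors p j k : Set (Fin n → ℕ)).PairwiseDisjoint (residueCone p j k) := by
  intro t ht t' ht' hne
  refine Set.disjoint_left.mpr fun x hx hx' => hne (funext fun i => ?_)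
  have hti := Fintype.mem_piFinset.mp ht i
  have hti' := Fintype.mem_piFinset.mp ht' i
  by_cases hi : i = j
  · simp only [hi, if_true, Finset.mem_singleton] at hti hti'
    rw [hi, hti, hti']
  · simp only [hi, if_false, Finset.mem_range] at hti hti'
    have h := norm_sub_le_of_mem_cone hx hx' hi
    rw [min_self, show (-fun i => (t i : ℚ_[p])) i - (-fun i => (t' i : ℚ_[p])) i =
      (((t' i : ℤ) - (t i : ℤ) : ℤ) : ℚ_[p]) by simp; ring, Padic.norm_int_le_pow_iff_dvd] at h
    have hmod : t i ≡ t' i [MOD p ^ k] := (Nat.modEq_iff_dvd).mpr h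
    exact hmod.eq_of_lt_of_lt hti hti'

lemma sum_measureReal_inter_residueCone (j : Fin n) (k : ℕ) {B : Set (Fin n → ℚ_[p])}
    (hB : MeasurableSet B) :
    ∑ t ∈ residueVectors p j k, (chartMeasure p j).real (B ∩ residueCone p j k t) =
      (chartMeasure p j).real B := by
  rw [← measureReal_biUnion_finset
    (fun t ht t' ht' hne => (pairwiseDisjoint_residueCone j k ht ht' hne).mono
      Set.inter_subset_right Set.inter_subset_right)
    fun t _ => hB.inter (measurableSet_residueCone j k t)]
  rw [chartMeasure, measureReal_restrict_apply' (measurableSet_chart j),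
    measureReal_restrict_apply' (measurableSet_chart j)]
  congr 1
  ext x
  simp only [Set.mem_inter_iff, Set.mem_iUnion]
  constructor
  · rintro ⟨⟨t, -, hB, -⟩, hc⟩
    exact ⟨hB, hc⟩
  · rintro ⟨hB, hc⟩
    obtain ⟨t, ht, hxt⟩ := exists_mem_residueCone hc k
    exact ⟨⟨t, ht, hB, hxt⟩, hc⟩

lemma preimage_chartMap_cone_zero (j : Fin n) {w : Fin n → ℚ_[p]} (hw : ∀ i, i ≠ j → ‖w i‖ ≤ 1)
    (k : ℕ) : chartMap j (-w) 1 one_ne_zero ⁻¹' cone j 0 k = cone j w k := by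
  have hch := preimage_chartMap_chart j (c := -w) (fun i hi => by simpa using hw i hi)
    (s := 1) one_ne_zero (m := 0) (by simp)
  rw [neg_neg, cone_zero_right j hw] at hch
  ext x
  have hx : chartMap j (-w) 1 one_ne_zero x ∈ chart p j ↔ x ∈ chart p j := by
    rw [← Set.mem_preimage, hch]
  rw [Set.mem_preimage, cone, cone, Set.mem_ofPred_eq, Set.mem_ofPred_eq, hx]
  refine and_congr_right fun _ => forall_congr' fun i => forall_congr' fun hi => ?_
  simp [chartMap_apply, hi, sub_eq_add_neg]

/-- All cones of level `k` have the same measure. -/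
lemma chartMeasure_real_cone (j : Fin n) {w : Fin n → ℚ_[p]} (hw : ∀ i, i ≠ j → ‖w i‖ ≤ 1)
    (k : ℕ) : (chartMeasure p j).real (cone j w k) =
      (chartMeasure p j).real Set.univ / ((p : ℝ) ^ k) ^ (n - 1) := by
  have hp : (0 : ℝ) < p := by exact_mod_cast (Fact.out : p.Prime).pos
  have hshear : ∀ w : Fin n → ℚ_[p], (∀ i, i ≠ j → ‖w i‖ ≤ 1) →
      (chartMeasure p j).real (cone j w k) = (chartMeasure p j).real (cone j 0 k) := by
    intro w hw
    have h := chartMeasure_real_preimage_mul j (c := -w) (fun i hi => by simpa using hw i hi)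
      (s := 1) one_ne_zero (m := 0) (by simp) (measurableSet_cone j 0 k) (cone_subset_chart j 0 k)
    have huniv : (chartMeasure p j).real (chart p j) = (chartMeasure p j).real Set.univ := by
      rw [chartMeasure_real_univ, chartMeasure_real_of_subset subset_rfl]
    rw [preimage_chartMap_cone_zero j hw, neg_neg, cone_zero_right j hw, huniv] at h
    rcases eq_or_ne ((chartMeasure p j).real Set.univ) 0 with h0 | h0
    · have hz : ∀ B, (chartMeasure p j).real B = 0 := fun B =>
        le_antisymm (h0 ▸ measureReal_mono (Set.subset_univ B)) measureReal_nonneg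
      rw [hz, hz]
    · exact mul_right_cancel₀ h0 h
  have hsum := sum_measureReal_inter_residueCone (p := p) j k MeasurableSet.univ
  simp only [Set.univ_inter] at hsum
  have hres : ∀ t, (chartMeasure p j).real (residueCone p j k t) =
      (chartMeasure p j).real (cone j 0 k) := fun t =>
    hshear _ fun i _ => norm_neg_natCast_le_one t i
  rw [Finset.sum_congr rfl fun t _ => hres t, Finset.sum_const, card_residueVectors,
    nsmul_eq_mul] at hsum
  rw [hshear w hw, eq_div_iff (by positivity), mul_comm, ← hsum]
  push_cast; ring

/-- If `V` has relative density at most `γ / μ(univ)` in every cone of level `k`, then also in every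
union of such cones. -/
lemma chartMeasure_real_inter_mul_le (j : Fin n) (k : ℕ) {A V : Set (Fin n → ℚ_[p])}
    (hA : MeasurableSet A) (hV : MeasurableSet V)
    (hsat : ∀ t, residueCone p j k t ⊆ A ∨ Disjoint (residueCone p j k t) A) {c γ : ℝ}
    (h : ∀ t ∈ residueVectors p j k, (chartMeasure p j).real (V ∩ residueCone p j k t) * c ≤
      (chartMeasure p j).real (residueCone p j k t) * γ) :
    (chartMeasure p j).real (V ∩ A) * c ≤ (chartMeasure p j).real A * γ := by
  rw [← sum_measureReal_inter_residueCone j k (hV.inter hA),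
    ← sum_measureReal_inter_residueCone j k hA, Finset.sum_mul, Finset.sum_mul]
  refine Finset.sum_le_sum fun t ht => ?_
  rcases hsat t with hs | hs
  · rw [Set.inter_assoc, Set.inter_eq_right.mpr hs]
    exact h t ht
  · rw [Set.inter_assoc, hs.symm.inter_eq]
    simp

/-- The points of the `j`-th chart within `p ^ (-k)` of a primitive vector with `j`-th coordinate
equal to `q`. -/
def approxSet (p : ℕ) [Fact p.Prime] {n : ℕ} (j : Fin n) (q k : ℕ) : Set (Fin n → ℚ_[p]) :=
  ⋃ v ∈ primVectors j q, cone j (fun i => (v i : ℚ_[p]) / q) k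

lemma measurableSet_approxSet (j : Fin n) (q k : ℕ) : MeasurableSet (approxSet p j q k) :=
  Finset.measurableSet_biUnion _ fun _ _ => measurableSet_cone _ _ _

lemma norm_natCast_eq_one {q : ℕ} (hq : ¬p ∣ q) : ‖(q : ℚ_[p])‖ = 1 :=
  Padic.norm_natCast_eq_one_iff.mpr ((Fact.out : p.Prime).coprime_iff_not_dvd.mpr hq)

lemma norm_intCast_div_le_one {q : ℕ} (hq : ¬p ∣ q) (a : ℤ) : ‖(a : ℚ_[p]) / q‖ ≤ 1 := by
  rw [norm_div, norm_natCast_eq_one hq, div_one]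
  exact Padic.norm_int_le_one a

lemma approxSet_saturated (j : Fin n) (q : ℕ) {k K : ℕ} (hk : k ≤ K) (t : Fin n → ℕ) :
    residueCone p j K t ⊆ approxSet p j q k ∨
      Disjoint (residueCone p j K t) (approxSet p j q k) := by
  rw [or_iff_not_imp_right, Set.not_disjoint_iff]
  rintro ⟨x, hx, hx'⟩
  simp only [approxSet, Set.mem_iUnion] at hx'
  obtain ⟨v, hv, hxv⟩ := hx'
  refine ((cone_subset_or_disjoint hk).resolve_right
    (Set.not_disjoint_iff.mpr ⟨x, hx, hxv⟩)).trans ?_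
  exact Set.subset_biUnion_of_mem
    (u := fun v : Fin n → ℤ => cone j (fun i => (v i : ℚ_[p]) / (q : ℚ_[p])) k) hv

lemma dvd_of_norm_div_sub_div_le {q q' : ℕ} (hq : ¬p ∣ q) (hq' : ¬p ∣ q') {a a' : ℤ} {k : ℕ}
    (h : ‖(a : ℚ_[p]) / q - (a' : ℚ_[p]) / q'‖ ≤ (p : ℝ) ^ (-(k : ℤ))) :
    ((p ^ k : ℕ) : ℤ) ∣ q * a' - q' * a := by
  have hq0 : (q : ℚ_[p]) ≠ 0 := norm_ne_zero_iff.mp (by rw [norm_natCast_eq_one hq]; simp)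
  have hq0' : (q' : ℚ_[p]) ≠ 0 := norm_ne_zero_iff.mp (by rw [norm_natCast_eq_one hq']; simp)
  rw [Nat.cast_pow, ← Padic.norm_int_le_pow_iff_dvd]
  refine le_trans (le_of_eq ?_) h
  rw [show (a : ℚ_[p]) / q - (a' : ℚ_[p]) / q' = -((q * a' - q' * a : ℤ) : ℚ_[p]) / (q * q') by
    push_cast; field_simp; ring]
  rw [norm_div, norm_neg, norm_mul, norm_natCast_eq_one hq, norm_natCast_eq_one hq']
  simp

/-- The measure of the intersection of two approximation sets, on average over pairs of vectors. -/
lemma sum_measureReal_cone_inter_le_of_ne (j : Fin n) {q q' k k' : ℕ} (hq : ¬p ∣ q) (hq' : ¬p ∣ q')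
    (hne : q ≠ q') :
    ∑ v ∈ primVectors j q, ∑ v' ∈ primVectors j q', (chartMeasure p j).real
      (cone j (fun i => (v i : ℚ_[p]) / q) k ∩ cone j (fun i => (v' i : ℚ_[p]) / q') k') ≤
    (chartMeasure p j).real Set.univ * 3 ^ (n - 1) *
      (((q : ℝ) / p ^ k) ^ (n - 1) * ((q' : ℝ) / p ^ k') ^ (n - 1)) := by
  have hp0 : 0 < p := (Fact.out : p.Prime).pos
  have hp : (0 : ℝ) < p := by exact_mod_cast hp0
  have hq0 : 0 < q := Nat.pos_of_ne_zero fun h => hq (h ▸ dvd_zero p)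
  set c := (chartMeasure p j).real Set.univ with hc
  have hc0 : 0 ≤ c := measureReal_nonneg
  rw [← Finset.sum_product']
  have hterm : ∀ vv ∈ primVectors j q ×ˢ primVectors j q', (chartMeasure p j).real
      (cone j (fun i => (vv.1 i : ℚ_[p]) / q) k ∩ cone j (fun i => (vv.2 i : ℚ_[p]) / q') k') ≤
      if ∀ i, i ≠ j → ((p ^ min k k' : ℕ) : ℤ) ∣ q * vv.2 i - q' * vv.1 i then
        c / ((p : ℝ) ^ max k k') ^ (n - 1) else 0 := by
    intro vv _
    split_ifs with h
    · rcases le_total k k' with hk | hk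
      · rw [max_eq_right hk, ← chartMeasure_real_cone j
          (fun i _ => norm_intCast_div_le_one hq' (vv.2 i)) k']
        exact measureReal_mono Set.inter_subset_right
      · rw [max_eq_left hk, ← chartMeasure_real_cone j
          (fun i _ => norm_intCast_div_le_one hq (vv.1 i)) k]
        exact measureReal_mono Set.inter_subset_left
    · rw [Set.eq_empty_of_forall_notMem (s := _ ∩ _) fun x hx => h fun i hi =>
        dvd_of_norm_div_sub_div_le hq hq' (norm_sub_le_of_mem_cone hx.1 hx.2 hi)]
      simp
  refine (Finset.sum_le_sum hterm).trans ?_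
  rw [← Finset.sum_filter, Finset.sum_const, nsmul_eq_mul]
  have hcard := card_closePairs_mul_le j (q' := q') hq0 (pow_pos hp0 (min k k'))
    (Nat.Coprime.pow_right _ (((Fact.out : p.Prime).coprime_iff_not_dvd.mpr hq).symm)) hne
  have hcard' : ((closePairs j q q' (p ^ min k k')).card : ℝ) * ((p : ℝ) ^ min k k') ^ (n - 1) ≤
      (3 * ((q : ℝ) * q')) ^ (n - 1) := by exact_mod_cast hcard
  change ((closePairs j q q' (p ^ min k k')).card : ℝ) * _ ≤ _
  have hkk : (p : ℝ) ^ k * (p : ℝ) ^ k' = (p : ℝ) ^ min k k' * (p : ℝ) ^ max k k' := by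
    rw [← pow_add, ← pow_add, min_add_max]
  calc ((closePairs j q q' (p ^ min k k')).card : ℝ) * (c / ((p : ℝ) ^ max k k') ^ (n - 1))
      = c * (((closePairs j q q' (p ^ min k k')).card : ℝ) * ((p : ℝ) ^ min k k') ^ (n - 1)) /
        ((p : ℝ) ^ min k k' * (p : ℝ) ^ max k k') ^ (n - 1) := by
        rw [mul_pow]; field_simp
    _ ≤ c * (3 * ((q : ℝ) * q')) ^ (n - 1) /
        ((p : ℝ) ^ min k k' * (p : ℝ) ^ max k k') ^ (n - 1) := by gcongr
    _ = _ := by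
        rw [← hkk, mul_pow, mul_pow, mul_pow, div_pow, div_pow]; field_simp

lemma sum_measureReal_cone_inter_le_self (j : Fin n) {q k : ℕ} (hq : ¬p ∣ q) (hqk : q ≤ p ^ k) :
    ∑ v ∈ primVectors j q, ∑ v' ∈ primVectors j q, (chartMeasure p j).real
      (cone j (fun i => (v i : ℚ_[p]) / q) k ∩ cone j (fun i => (v' i : ℚ_[p]) / q) k) ≤
    (chartMeasure p j).real Set.univ * ((q : ℝ) / p ^ k) ^ (n - 1) := by
  have hp0 : 0 < p := (Fact.out : p.Prime).pos
  have hp : (0 : ℝ) < p := by exact_mod_cast hp0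
  have hc0 : 0 ≤ (chartMeasure p j).real Set.univ := measureReal_nonneg
  have hterm : ∀ v ∈ primVectors j q, ∑ v' ∈ primVectors j q, (chartMeasure p j).real
      (cone j (fun i => (v i : ℚ_[p]) / q) k ∩ cone j (fun i => (v' i : ℚ_[p]) / q) k) =
      (chartMeasure p j).real Set.univ / ((p : ℝ) ^ k) ^ (n - 1) := by
    intro v hv
    rw [Finset.sum_eq_single_of_mem v hv, Set.inter_self,
      chartMeasure_real_cone j fun i _ => norm_intCast_div_le_one hq (v i)]
    intro v' hv' hne
    rw [Set.eq_empty_of_forall_notMem (s := _ ∩ _) fun x hx => hne ?_]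
    · simp
    · obtain ⟨hvj, hvi, -⟩ := mem_primVectors.mp hv
      obtain ⟨hvj', hvi', -⟩ := mem_primVectors.mp hv'
      funext i
      by_cases hi : i = j
      · rw [hi, hvj, hvj']
      · have hd := dvd_of_norm_div_sub_div_le hq hq
          (norm_sub_le_of_mem_cone hx.1 hx.2 hi)
        rw [min_self, ← mul_sub] at hd
        have hcop : IsCoprime ((p ^ k : ℕ) : ℤ) q := by
          rw [Nat.isCoprime_iff_coprime]
          exact Nat.Coprime.pow_left _ ((Fact.out : p.Prime).coprime_iff_not_dvd.mpr hq)
        have hd' := hcop.dvd_of_dvd_mul_left hd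
        have hqk' : (q : ℤ) ≤ (p ^ k : ℕ) := by exact_mod_cast hqk
        have h0 := Int.eq_zero_of_abs_lt_dvd hd' (by
          rw [abs_lt]; have := hvi i hi; have := hvi' i hi; constructor <;> linarith)
        linarith
  rw [Finset.sum_congr rfl hterm, Finset.sum_const, nsmul_eq_mul, div_pow, mul_div_assoc',
    mul_div_assoc', mul_comm]
  gcongr
  exact_mod_cast card_primVectors_le j q

/-- Second moment bound for the cones composing the approximation sets. -/
lemma sum_measureReal_cone_inter_le (j : Fin n) (F : Finset ℕ) (k : ℕ → ℕ)
    (hF : ∀ q ∈ F, ¬p ∣ q ∧ q ≤ p ^ k q) :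
    ∑ q ∈ F, ∑ q' ∈ F, ∑ v ∈ primVectors j q, ∑ v' ∈ primVectors j q', (chartMeasure p j).real
      (cone j (fun i => (v i : ℚ_[p]) / q) (k q) ∩ cone j (fun i => (v' i : ℚ_[p]) / q') (k q')) ≤
    (chartMeasure p j).real Set.univ * ∑ q ∈ F, ((q : ℝ) / p ^ k q) ^ (n - 1) +
      (chartMeasure p j).real Set.univ * 3 ^ (n - 1) *
        (∑ q ∈ F, ((q : ℝ) / p ^ k q) ^ (n - 1)) ^ 2 := by
  have hc0 : 0 ≤ (chartMeasure p j).real Set.univ := measureReal_nonneg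
  have hterm : ∀ q ∈ F, ∀ q' ∈ F, ∑ v ∈ primVectors j q, ∑ v' ∈ primVectors j q',
      (chartMeasure p j).real (cone j (fun i => (v i : ℚ_[p]) / q) (k q) ∩
        cone j (fun i => (v' i : ℚ_[p]) / q') (k q')) ≤
      (if q = q' then (chartMeasure p j).real Set.univ * ((q : ℝ) / p ^ k q) ^ (n - 1) else 0) +
        (chartMeasure p j).real Set.univ * 3 ^ (n - 1) *
          (((q : ℝ) / p ^ k q) ^ (n - 1) * ((q' : ℝ) / p ^ k q') ^ (n - 1)) := by
    intro q hq q' hq'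
    by_cases h : q = q'
    · subst h
      rw [if_pos rfl]
      exact (sum_measureReal_cone_inter_le_self j (hF q hq).1 (hF q hq).2).trans
        (le_add_of_nonneg_right (by positivity))
    · rw [if_neg h, zero_add]
      exact sum_measureReal_cone_inter_le_of_ne j (hF q hq).1 (hF q' hq').1 h
  refine (Finset.sum_le_sum fun q hq => Finset.sum_le_sum fun q' hq' =>
    hterm q hq q' hq').trans (le_of_eq ?_)
  simp only [Finset.sum_add_distrib, Finset.sum_ite_eq, ← Finset.mul_sum]
  rw [Finset.sum_congr rfl fun q hq => if_pos hq, ← Finset.mul_sum, sq, ← Finset.sum_mul]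

/-- Quantitative lower bound for the measure of a finite union of approximation sets. -/
lemma chartMeasure_real_univ_le_of_one_le_sum (hn : 2 < n) (j : Fin n) (F : Finset ℕ) (k : ℕ → ℕ)
    (hF : ∀ q ∈ F, ¬p ∣ q ∧ q ≤ p ^ k q)
    (hM : 1 ≤ ∑ q ∈ F, ((q : ℝ) / p ^ k q) ^ (n - 1)) :
    (chartMeasure p j).real Set.univ ≤
      16 * (3 ^ (n - 1) + 1) * (chartMeasure p j).real (⋃ q ∈ F, approxSet p j q (k q)) := by
  have hp : (0 : ℝ) < p := by exact_mod_cast (Fact.out : p.Prime).pos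
  set c := (chartMeasure p j).real Set.univ with hc
  set M := ∑ q ∈ F, ((q : ℝ) / p ^ k q) ^ (n - 1) with hMdef
  have hc0 : 0 ≤ c := measureReal_nonneg
  let D : (Σ _ : ℕ, Fin n → ℤ) → Set (Fin n → ℚ_[p]) :=
    fun a => cone j (fun i => (a.2 i : ℚ_[p]) / (a.1 : ℚ_[p])) (k a.1)
  have hce := sq_sum_measureReal_le (chartMeasure p j) (F.sigma fun q => primVectors j q)
    (D := D) fun a => measurableSet_cone _ _ _
  have hU : (⋃ a ∈ F.sigma fun q => primVectors j q, D a) = ⋃ q ∈ F, approxSet p j q (k q) := by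
    ext x
    simp only [Set.mem_iUnion, Finset.mem_sigma, approxSet, D]
    constructor
    · rintro ⟨⟨q, v⟩, ⟨hq, hv⟩, hx⟩
      exact ⟨q, hq, v, hv, hx⟩
    · rintro ⟨q, hq, v, hv, hx⟩
      exact ⟨⟨q, v⟩, ⟨hq, hv⟩, hx⟩
  have hS1 : c * M / 4 ≤ ∑ a ∈ F.sigma fun q => primVectors j q, (chartMeasure p j).real (D a) := by
    rw [Finset.sum_sigma, mul_div_assoc, hMdef, Finset.sum_div, Finset.mul_sum]
    refine Finset.sum_le_sum fun q hq => ?_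
    have hqp := (hF q hq).1
    have hq0 : 0 < q := Nat.pos_of_ne_zero fun h => hqp (h ▸ dvd_zero p)
    rw [Finset.sum_congr rfl fun v _ =>
      chartMeasure_real_cone j (fun i _ => norm_intCast_div_le_one hqp (v i)) (k q),
      Finset.sum_const, nsmul_eq_mul, div_pow, ← hc]
    have h4 := pow_le_four_mul_card_primVectors hn j hq0
    have hpk : (0 : ℝ) < ((p : ℝ) ^ k q) ^ (n - 1) := by positivity
    rw [mul_div_assoc', mul_div_assoc', div_div, mul_comm (_ ^ (n - 1)) (4 : ℝ), mul_div_assoc',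
      div_le_div_iff₀ (by positivity) hpk]
    nlinarith [mul_le_mul_of_nonneg_left h4 (mul_nonneg hc0 hpk.le)]
  have hS2 : ∑ a ∈ F.sigma fun q => primVectors j q, ∑ b ∈ F.sigma fun q => primVectors j q,
      (chartMeasure p j).real (D a ∩ D b) ≤ c * M + c * 3 ^ (n - 1) * M ^ 2 := by
    refine le_of_eq_of_le ?_ (sum_measureReal_cone_inter_le j F k hF)
    rw [Finset.sum_sigma]
    refine Finset.sum_congr rfl fun q _ => ?_
    refine Eq.trans (Finset.sum_congr rfl fun v _ => ?_) Finset.sum_comm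
    rw [Finset.sum_sigma]
  rw [hU] at hce
  set U := (chartMeasure p j).real (⋃ q ∈ F, approxSet p j q (k q)) with hUdef
  have hU0 : 0 ≤ U := measureReal_nonneg
  rcases hc0.eq_or_lt with h0 | hcpos
  · rw [← h0]; positivity
  have hMsq : c * M + c * 3 ^ (n - 1) * M ^ 2 ≤ c * (3 ^ (n - 1) + 1) * M ^ 2 := by
    nlinarith [mul_le_mul_of_nonneg_left (mul_le_mul_of_nonneg_left hM (by linarith : 0 ≤ M)) hc0]
  have h1 : (c * M / 4) ^ 2 ≤ U * (c * (3 ^ (n - 1) + 1) * M ^ 2) :=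
    (pow_le_pow_left₀ (by positivity) hS1 2).trans
      (hce.trans (mul_le_mul_of_nonneg_left (hS2.trans hMsq) hU0))
  have h2 : 0 < c * M ^ 2 := by positivity
  refine le_of_mul_le_mul_left ?_ h2
  nlinarith [h1]

/-- The points belonging to some `approxSet p j q (k q)` with `q ∈ S` and `q ≥ Q`. -/
def tailSet (p : ℕ) [Fact p.Prime] {n : ℕ} (j : Fin n) (S : Set ℕ) (k : ℕ → ℕ) (Q : ℕ) :
    Set (Fin n → ℚ_[p]) := {x | ∃ q ∈ S, Q ≤ q ∧ x ∈ approxSet p j q (k q)}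

/-- The points belonging to infinitely many `approxSet p j q (k q)` with `q ∈ S`. -/
def limsupSet (p : ℕ) [Fact p.Prime] {n : ℕ} (j : Fin n) (S : Set ℕ) (k : ℕ → ℕ) :
    Set (Fin n → ℚ_[p]) := ⋂ Q, tailSet p j S k Q

open Classical in
/-- The union of the `approxSet p j q (k q)` with `q ∈ S` and `Q ≤ q < R`. -/
def partialSet (p : ℕ) [Fact p.Prime] {n : ℕ} (j : Fin n) (S : Set ℕ) (k : ℕ → ℕ) (Q R : ℕ) :
    Set (Fin n → ℚ_[p]) := ⋃ q ∈ {q ∈ Finset.Ico Q R | q ∈ S}, approxSet p j q (k q)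

lemma mem_partialSet {j : Fin n} {S : Set ℕ} {k : ℕ → ℕ} {Q R : ℕ} {x : Fin n → ℚ_[p]} :
    x ∈ partialSet p j S k Q R ↔ ∃ q ∈ S, Q ≤ q ∧ q < R ∧ x ∈ approxSet p j q (k q) := by
  simp only [partialSet, Set.mem_iUnion, Finset.mem_filter, Finset.mem_Ico]
  constructor
  · rintro ⟨q, ⟨⟨h1, h2⟩, h3⟩, h4⟩; exact ⟨q, h3, h1, h2, h4⟩
  · rintro ⟨q, h3, h1, h2, h4⟩; exact ⟨q, ⟨⟨h1, h2⟩, h3⟩, h4⟩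

lemma measurableSet_partialSet (j : Fin n) (S : Set ℕ) (k : ℕ → ℕ) (Q R : ℕ) :
    MeasurableSet (partialSet p j S k Q R) :=
  Finset.measurableSet_biUnion _ fun _ _ => measurableSet_approxSet _ _ _

lemma tailSet_eq_iUnion (j : Fin n) (S : Set ℕ) (k : ℕ → ℕ) (Q : ℕ) :
    tailSet p j S k Q = ⋃ R, partialSet p j S k Q R := by
  ext x
  simp only [Set.mem_iUnion, mem_partialSet, tailSet, Set.mem_ofPred_eq]
  constructor
  · rintro ⟨q, hq, hQ, hx⟩; exact ⟨q + 1, q, hq, hQ, q.lt_succ_self, hx⟩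
  · rintro ⟨R, q, hq, hQ, -, hx⟩; exact ⟨q, hq, hQ, hx⟩

lemma measurableSet_tailSet (j : Fin n) (S : Set ℕ) (k : ℕ → ℕ) (Q : ℕ) :
    MeasurableSet (tailSet p j S k Q) := by
  rw [tailSet_eq_iUnion]
  exact MeasurableSet.iUnion fun R => measurableSet_partialSet j S k Q R

lemma measurableSet_limsupSet (j : Fin n) (S : Set ℕ) (k : ℕ → ℕ) :
    MeasurableSet (limsupSet p j S k) := MeasurableSet.iInter fun Q => measurableSet_tailSet j S k Q

lemma tendsto_measureReal_partialSet (j : Fin n) (S : Set ℕ) (k : ℕ → ℕ) (Q : ℕ) :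
    Filter.Tendsto (fun R => (chartMeasure p j).real (partialSet p j S k Q R)) Filter.atTop
      (nhds ((chartMeasure p j).real (tailSet p j S k Q))) := by
  rw [tailSet_eq_iUnion]
  refine (ENNReal.tendsto_toReal (measure_ne_top _ _)).comp (tendsto_measure_iUnion_atTop ?_)
  intro R R' hR x hx
  obtain ⟨q, hq, hQ, hqR, hx⟩ := mem_partialSet.mp hx
  exact mem_partialSet.mpr ⟨q, hq, hQ, hqR.trans_le hR, hx⟩

lemma tendsto_measureReal_tailSet (j : Fin n) (S : Set ℕ) (k : ℕ → ℕ) :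
    Filter.Tendsto (fun Q => (chartMeasure p j).real (tailSet p j S k Q)) Filter.atTop
      (nhds ((chartMeasure p j).real (limsupSet p j S k))) := by
  refine (ENNReal.tendsto_toReal (measure_ne_top _ _)).comp (tendsto_measure_iInter_atTop
    (fun Q => (measurableSet_tailSet j S k Q).nullMeasurableSet) ?_ ⟨0, measure_ne_top _ _⟩)
  rintro Q Q' hQ x ⟨q, hq, hQq, hx⟩
  exact ⟨q, hq, hQ.trans hQq, hx⟩

lemma chartMeasure_real_univ_le_limsupSet (hn : 2 < n) (j : Fin n) {S : Set ℕ} {k : ℕ → ℕ}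
    (hS : ∀ q ∈ S, ¬p ∣ q ∧ q ≤ p ^ k q)
    (hdiv : ¬Summable (S.indicator fun q : ℕ => ((q : ℝ) / p ^ k q) ^ (n - 1))) :
    (chartMeasure p j).real Set.univ ≤
      16 * (3 ^ (n - 1) + 1) * (chartMeasure p j).real (limsupSet p j S k) := by
  classical
  have ha : ∀ q, 0 ≤ S.indicator (fun q : ℕ => ((q : ℝ) / p ^ k q) ^ (n - 1)) q := fun q =>
    Set.indicator_nonneg (fun q _ => by positivity) q
  rw [not_summable_iff_tendsto_nat_atTop_of_nonneg ha] at hdiv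
  refine ge_of_tendsto' ((tendsto_measureReal_tailSet j S k).const_mul _) fun Q => ?_
  set A := ∑ q ∈ Finset.range Q, S.indicator (fun q : ℕ => ((q : ℝ) / p ^ k q) ^ (n - 1)) q
  obtain ⟨R, hR, hQR⟩ := ((hdiv.eventually_ge_atTop (A + 1)).and
    (Filter.eventually_ge_atTop Q)).exists
  have hsum := Finset.sum_range_add_sum_Ico
    (S.indicator fun q : ℕ => ((q : ℝ) / p ^ k q) ^ (n - 1)) hQR
  have h := chartMeasure_real_univ_le_of_one_le_sum hn j {q ∈ Finset.Ico Q R | q ∈ S} k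
    (fun q hq => hS q (Finset.mem_filter.mp hq).2) (by
      rw [Finset.sum_filter]
      simp only [A, Set.indicator_apply] at hsum hR
      linarith)
  refine h.trans (mul_le_mul_of_nonneg_left (measureReal_mono ?_) (by positivity))
  rw [tailSet_eq_iUnion]
  refine subset_trans (le_of_eq ?_) (Set.subset_iUnion _ R)
  ext x
  simp [partialSet]

lemma approxSet_subset_chart (j : Fin n) (q k : ℕ) : approxSet p j q k ⊆ chart p j :=
  Set.iUnion₂_subset fun _ _ => cone_subset_chart _ _ _

lemma limsupSet_subset_chart (j : Fin n) (S : Set ℕ) (k : ℕ → ℕ) :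
    limsupSet p j S k ⊆ chart p j := fun x hx => by
  obtain ⟨q, -, -, hx⟩ := Set.mem_iInter.mp hx 0
  exact approxSet_subset_chart j q _ hx

lemma zpow_neg_p_ne_zero (p : ℕ) [Fact p.Prime] (m : ℕ) : ((p : ℚ_[p]) ^ (-(m : ℤ))) ≠ 0 :=
  zpow_ne_zero _ (by exact_mod_cast (Fact.out : p.Prime).ne_zero)

/-- Zooming into a residue cone of level `m` sends approximation sets into approximation sets whose
radius is `p ^ m` times larger. -/
lemma chartMap_mem_approxSet {j : Fin n} {q k k' m : ℕ} (hq : ¬p ∣ q) (hk : k + m ≤ k')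
    {t : Fin n → ℕ} (ht : t ∈ residueVectors p j m) {x : Fin n → ℚ_[p]}
    (hx : x ∈ approxSet p j q k') (hxt : x ∈ residueCone p j m t) :
    chartMap j (fun i => (t i : ℚ_[p])) _ (zpow_neg_p_ne_zero p m) x ∈ approxSet p j q k := by
  have hp0 : 0 < p := (Fact.out : p.Prime).pos
  have hp : (0 : ℝ) < p := by exact_mod_cast hp0
  have hpp : (p : ℚ_[p]) ≠ 0 := by exact_mod_cast hp0.ne'
  have hpm : (0 : ℤ) < ((p ^ m : ℕ) : ℤ) := by exact_mod_cast pow_pos hp0 m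
  have hq0 : (0 : ℤ) < q := by
    exact Nat.cast_pos.mpr (Nat.pos_of_ne_zero fun h => hq (h ▸ dvd_zero p))
  have hqp : (q : ℚ_[p]) ≠ 0 := by exact_mod_cast hq0.ne'
  simp only [approxSet, Set.mem_iUnion] at hx ⊢
  obtain ⟨v, hv, hxv⟩ := hx
  obtain ⟨hvj, hvi, hprim⟩ := mem_primVectors.mp hv
  have hdvd : ∀ i, i ≠ j → ((p ^ m : ℕ) : ℤ) ∣ v i + t i * q := fun i hi => by
    have h := norm_sub_le_of_mem_cone hxv hxt hi
    rw [min_eq_right (by omega)] at h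
    have h1 := dvd_of_norm_div_sub_div_le (q' := 1) (a' := -(t i : ℤ)) hq
      (Fact.out : p.Prime).not_dvd_one (by simpa using h)
    have h2 : v i + t i * q = -((q : ℤ) * -(t i : ℤ) - (1 : ℕ) * v i) := by push_cast; ring
    rw [h2]
    exact h1.neg_right
  choose! u hu using hdvd
  have hw : (fun i => if i = j then (q : ℤ) else u i) ∈ primVectors j q := by
    refine mem_primVectors.mpr ⟨if_pos rfl, fun i hi => ?_, ?_⟩
    · rw [if_neg hi]
      have hti : (t i : ℤ) + 1 ≤ ((p ^ m : ℕ) : ℤ) := by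
        have := Fintype.mem_piFinset.mp ht i
        rw [if_neg hi, Finset.mem_range] at this
        exact_mod_cast this
      have h0 : 0 ≤ v i + t i * q := by have := (hvi i hi).1; positivity
      have h1 : v i + t i * q < (p ^ m : ℕ) * q := by
        have := (hvi i hi).2; nlinarith
      rw [hu i hi] at h0 h1
      exact ⟨nonneg_of_mul_nonneg_right h0 hpm, lt_of_mul_lt_mul_left h1 hpm.le⟩
    · rw [IsPrim, ← Finset.normalize_gcd, normalize_eq_one]
      refine isUnit_of_dvd_one ?_
      rw [← (hprim : Finset.univ.gcd v = 1)]
      have hdj : Finset.univ.gcd (fun i => if i = j then (q : ℤ) else u i) ∣ q := by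
        simpa using Finset.gcd_dvd (f := fun i => if i = j then (q : ℤ) else u i)
          (Finset.mem_univ j)
      refine Finset.dvd_gcd fun i _ => ?_
      by_cases hi : i = j
      · rw [hi, hvj]; exact hdj
      · have hdi := Finset.gcd_dvd (f := fun i => if i = j then (q : ℤ) else u i)
          (Finset.mem_univ i)
        simp only [hi, if_false] at hdi
        have := (dvd_add_left (hdj.mul_left (t i : ℤ))).mp (hu i hi ▸ hdi.mul_left _)
        exact this
  refine ⟨_, hw, ?_, fun i hi => ?_⟩
  · rw [← Set.mem_preimage, preimage_chartMap_chart (m := m) j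
      (fun i _ => by simpa using norm_neg_natCast_le_one (p := p) t i) _ (by simp)]
    exact hxt
  · have hcast : (v i : ℚ_[p]) + t i * q = (p : ℚ_[p]) ^ m * u i := by
      exact_mod_cast hu i hi
    simp only [chartMap_apply, hi, if_false, if_true]
    have hid : (p : ℚ_[p]) ^ (-(m : ℤ)) * (x i + t i * x j) - (u i : ℚ_[p]) / q * x j =
        (p : ℚ_[p]) ^ (-(m : ℤ)) * (x i - (v i : ℚ_[p]) / q * x j) := by
      rw [zpow_neg, zpow_natCast, eq_sub_of_add_eq hcast]
      field_simp
      ring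
    rw [hid, norm_mul, Padic.norm_p_zpow, neg_neg]
    refine (mul_le_mul_of_nonneg_left (hxv.2 i hi) (by positivity)).trans ?_
    rw [← mul_assoc, ← zpow_add₀ hp.ne']
    refine mul_le_mul_of_nonneg_right (zpow_le_zpow_right₀ ?_ (by omega)) (norm_nonneg _)
    exact_mod_cast hp0

lemma chartMeasure_real_limsupSet_inter_mul_le (j : Fin n) {S : Set ℕ} {k e : ℕ → ℕ}
    (hS : ∀ q ∈ S, ¬p ∣ q) (he : Filter.Tendsto e Filter.atTop Filter.atTop) (m : ℕ)
    {t : Fin n → ℕ} (ht : t ∈ residueVectors p j m) :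
    (chartMeasure p j).real (limsupSet p j S (k + e) ∩ residueCone p j m t) *
        (chartMeasure p j).real Set.univ ≤
      (chartMeasure p j).real (residueCone p j m t) *
        (chartMeasure p j).real (limsupSet p j S k) := by
  have hsub : limsupSet p j S (k + e) ∩ residueCone p j m t ⊆
      chartMap j (fun i => (t i : ℚ_[p])) _ (zpow_neg_p_ne_zero p m) ⁻¹' limsupSet p j S k := by
    rintro x ⟨hx, hxt⟩
    refine Set.mem_iInter.mpr fun Q => ?_
    obtain ⟨N, hN⟩ := (he.eventually_ge_atTop m).exists_forall_of_atTop
    obtain ⟨q, hq, hQ, hx⟩ := Set.mem_iInter.mp hx (max N Q)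
    exact ⟨q, hq, (le_max_right _ _).trans hQ, chartMap_mem_approxSet (hS q hq)
      (Nat.add_le_add_left (hN q ((le_max_left _ _).trans hQ)) _) ht hx hxt⟩
  have h := chartMeasure_real_preimage_mul j (m := m) (c := fun i => (t i : ℚ_[p]))
    (fun i _ => by simpa using norm_neg_natCast_le_one (p := p) t i)
    (zpow_neg_p_ne_zero p m) (by simp) (measurableSet_limsupSet j S k)
    (limsupSet_subset_chart j S k)
  rw [mul_comm (_ : ℝ) ((chartMeasure p j).real (limsupSet p j S k))]
  exact (mul_le_mul_of_nonneg_right (measureReal_mono hsub) measureReal_nonneg).trans h.le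

lemma partialSet_saturated (j : Fin n) (S : Set ℕ) {k : ℕ → ℕ} {Q R K : ℕ}
    (hK : ∀ q < R, k q ≤ K) (t : Fin n → ℕ) :
    residueCone p j K t ⊆ partialSet p j S k Q R ∨
      Disjoint (residueCone p j K t) (partialSet p j S k Q R) := by
  rw [or_iff_not_imp_right, Set.not_disjoint_iff]
  rintro ⟨x, hx, hx'⟩
  obtain ⟨q, hq, hQ, hR, hxq⟩ := mem_partialSet.mp hx'
  intro y hy
  exact mem_partialSet.mpr ⟨q, hq, hQ, hR, (approxSet_saturated j q (hK q hR) t).resolve_right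
    (Set.not_disjoint_iff.mpr ⟨x, hx, hxq⟩) hy⟩

/-- The limsup set has full measure in the chart. -/
lemma chartMeasure_real_univ_le_real_limsupSet (hn : 2 < n) (j : Fin n) {S : Set ℕ} {k : ℕ → ℕ}
    (hS : ∀ q ∈ S, ¬p ∣ q ∧ q ≤ p ^ k q)
    (hdiv : ¬Summable (S.indicator fun q : ℕ => ((q : ℝ) / p ^ k q) ^ (n - 1))) :
    (chartMeasure p j).real Set.univ ≤ (chartMeasure p j).real (limsupSet p j S k) := by
  have hp1 : 1 < p := (Fact.out : p.Prime).one_lt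
  obtain ⟨e, he, hdiv'⟩ := exists_tendsto_not_summable_div_pow
    (fun q => Set.indicator_nonneg (fun q _ => by positivity) q) hdiv
    (Nat.one_lt_pow (by omega : n - 1 ≠ 0) hp1)
  have hind : (fun q => S.indicator (fun q : ℕ => ((q : ℝ) / p ^ k q) ^ (n - 1)) q /
      ((p ^ (n - 1) : ℕ) : ℝ) ^ e q) =
      S.indicator fun q : ℕ => ((q : ℝ) / p ^ (k + e) q) ^ (n - 1) := by
    funext q
    by_cases hq : q ∈ S
    · simp only [Set.indicator_of_mem hq, Pi.add_apply, div_pow, pow_add, mul_pow]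
      push_cast
      rw [div_div, ← pow_mul, ← pow_mul, ← pow_mul, mul_comm (n - 1) (e q)]
    · simp [Set.indicator_of_notMem hq]
  rw [hind] at hdiv'
  have hpos := chartMeasure_real_univ_le_limsupSet hn j (k := k + e)
    (fun q hq => ⟨(hS q hq).1, (hS q hq).2.trans
      (Nat.pow_le_pow_right hp1.le (Nat.le_add_right _ _))⟩) hdiv'
  set μ := chartMeasure p j with hμ
  set V := limsupSet p j S (k + e) with hV
  set γ := μ.real (limsupSet p j S k) with hγ
  set c := μ.real Set.univ with hc
  have hVm : MeasurableSet V := measurableSet_limsupSet j S (k + e)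
  have hpart : ∀ Q R, (μ.real V - μ.real (tailSet p j S (k + e) Q) +
      μ.real (partialSet p j S (k + e) Q R)) * c ≤
        μ.real (partialSet p j S (k + e) Q R) * γ := by
    intro Q R
    set A := partialSet p j S (k + e) Q R with hA
    have hAm : MeasurableSet A := measurableSet_partialSet j S (k + e) Q R
    have hAT : A ⊆ tailSet p j S (k + e) Q := by
      rw [tailSet_eq_iUnion]
      exact Set.subset_iUnion (partialSet p j S (k + e) Q) R
    have hdens : μ.real (V ∩ A) * c ≤ μ.real A * γ :=
      chartMeasure_real_inter_mul_le j ((Finset.range R).sup (k + e)) hAm hVm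
        (partialSet_saturated j S fun q hq => Finset.le_sup (Finset.mem_range.mpr hq))
        fun t ht => chartMeasure_real_limsupSet_inter_mul_le j (fun q hq => (hS q hq).1) he _ ht
    refine le_trans (mul_le_mul_of_nonneg_right ?_ measureReal_nonneg) hdens
    have h1 : μ.real (V ∩ A) + μ.real (V \ A) = μ.real V := measureReal_inter_add_sdiff hAm
    have h2 : μ.real (V \ A) ≤ μ.real (tailSet p j S (k + e) Q \ A) :=
      measureReal_mono (Set.sdiff_subset_sdiff_left (Set.iInter_subset _ Q))
    have h3 := measureReal_sdiff (μ := μ) hAT hAm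
    linarith
  have hlimR : ∀ Q, μ.real V * c ≤ μ.real (tailSet p j S (k + e) Q) * γ := fun Q => by
    have ht := tendsto_measureReal_partialSet (p := p) j S (k + e) Q
    have := le_of_tendsto_of_tendsto' ((ht.const_add
      (μ.real V - μ.real (tailSet p j S (k + e) Q))).mul_const c) (ht.mul_const γ) (hpart Q)
    rwa [← hμ, sub_add_cancel] at this
  have hlim : μ.real V * c ≤ μ.real V * γ :=
    ge_of_tendsto' ((tendsto_measureReal_tailSet (p := p) j S (k + e)).mul_const γ) hlimR
  rcases (measureReal_nonneg : 0 ≤ μ.real V).eq_or_lt with h0 | h0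
  · rw [← h0, mul_zero] at hpos
    exact hpos.trans measureReal_nonneg
  · exact le_of_mul_le_mul_left hlim h0

lemma padicDelta_le {j : Fin n} {q : ℕ} (hq : ¬p ∣ q) {v : Fin n → ℤ} (hv : v j = q)
    {x : Fin n → ℚ_[p]} (hxj : x j ≠ 0) (hx : ∀ i, ‖x i‖ ≤ ‖x j‖) {r : ℝ} (hr : 0 ≤ r)
    (h : ∀ i, i ≠ j → ‖x i - (v i : ℚ_[p]) / q * x j‖ ≤ r * ‖x j‖) :
    padicDelta p x (intPadic p v) ≤ r := by
  have hpos : 0 < ‖x j‖ := norm_pos_iff.mpr hxj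
  have hqn := norm_natCast_eq_one hq
  have hq0 : (q : ℚ_[p]) ≠ 0 := norm_ne_zero_iff.mp (by rw [hqn]; exact one_ne_zero)
  have hnx : ‖x‖ = ‖x j‖ :=
    le_antisymm ((pi_norm_le_iff_of_nonneg hpos.le).mpr hx) (norm_le_pi_norm x j)
  have hnv : ‖intPadic p v‖ = 1 := by
    refine le_antisymm ((pi_norm_le_iff_of_nonneg zero_le_one).mpr fun i =>
      Padic.norm_int_le_one (v i)) ?_
    calc (1 : ℝ) = ‖intPadic p v j‖ := by rw [intPadic, hv, Int.cast_natCast, hqn]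
      _ ≤ _ := norm_le_pi_norm _ j
  have h' : ∀ i, ‖x i - (v i : ℚ_[p]) / q * x j‖ ≤ r * ‖x j‖ := fun i => by
    by_cases hi : i = j
    · rw [hi, hv, Int.cast_natCast, div_self hq0, one_mul, sub_self, norm_zero]
      positivity
    · exact h i hi
  have hmul : ∀ i l, ‖(x i - (v i : ℚ_[p]) / q * x j) * v l‖ ≤ r * ‖x j‖ := fun i l => by
    rw [norm_mul]
    exact (mul_le_of_le_one_right (norm_nonneg _) (Padic.norm_int_le_one _)).trans (h' i)
  rw [padicDelta, hnx, hnv, mul_one, div_le_iff₀ hpos]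
  have : Nonempty (Fin n × Fin n) := ⟨(j, j)⟩
  refine ciSup_le fun il => ?_
  simp only [intPadic]
  rw [show x il.1 * (v il.2 : ℚ_[p]) - x il.2 * (v il.1 : ℚ_[p]) =
    (x il.1 - (v il.1 : ℚ_[p]) / q * x j) * v il.2 +
      -((x il.2 - (v il.2 : ℚ_[p]) / q * x j) * v il.1) by ring]
  refine (IsUltrametricDist.norm_add_le_max _ _).trans (max_le (hmul _ _) ?_)
  rw [norm_neg]
  exact hmul _ _

lemma Hsup_of_mem_primVectors {j : Fin n} {q : ℕ} {v : Fin n → ℤ} (hv : v ∈ primVectors j q) :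
    Hsup v = q := by
  obtain ⟨hvj, hvi, -⟩ := mem_primVectors.mp hv
  refine le_antisymm (Finset.sup_le fun i _ => ?_) ?_
  · by_cases hi : i = j
    · rw [hi, hvj, Int.natAbs_natCast]
    · have := hvi i hi
      omega
  · calc q = (v j).natAbs := by rw [hvj, Int.natAbs_natCast]
      _ ≤ _ := Finset.le_sup (f := fun i => (v i).natAbs) (Finset.mem_univ j)

/-- Points of a limsup set are infinitely often `ψ`-approximable. -/
lemma mk_mem_Wp_of_mem_limsupSet {j : Fin n} {S : Set ℕ} {k : ℕ → ℕ} {ψ : ℕ → ℝ}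
    (hS : ∀ q ∈ S, ¬p ∣ q ∧ (p : ℝ) ^ (-(k q : ℤ)) ≤ ψ q) {x : Fin n → ℚ_[p]} (hx0 : x ≠ 0)
    (hx : x ∈ limsupSet p j S k) : Projectivization.mk ℚ_[p] x hx0 ∈ Wp p n ψ := by
  have hchart : x ∈ chart p j := limsupSet_subset_chart j S k hx
  have hinf : {q | q ∈ S ∧ x ∈ approxSet p j q (k q)}.Infinite := by
    refine Set.infinite_of_not_bddAbove fun ⟨B, hB⟩ => ?_
    obtain ⟨q, hq, hQ, hxq⟩ := Set.mem_iInter.mp hx (B + 1)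
    exact absurd (hB ⟨hq, hxq⟩) (by omega)
  have hex : ∀ q : {q | q ∈ S ∧ x ∈ approxSet p j q (k q)}, ∃ v ∈ primVectors j q.1,
      x ∈ cone j (fun i => (v i : ℚ_[p]) / (q.1 : ℚ_[p])) (k q.1) := fun q => by
    have := q.2.2
    simp only [approxSet, Set.mem_iUnion] at this
    obtain ⟨v, hv, hxv⟩ := this
    exact ⟨v, hv, hxv⟩
  choose v hv hxv using hex
  have hv0 : ∀ q, intRat (v q) ≠ 0 := fun q h => by
    have h1 := congrFun h j
    rw [intRat, (mem_primVectors.mp (hv q)).1] at h1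
    have h2 : q.1 = 0 := by simpa using h1
    exact (hS q.1 q.2.1).1 (h2 ▸ dvd_zero p)
  have : Infinite {q | q ∈ S ∧ x ∈ approxSet p j q (k q)} := hinf.to_subtype
  refine (Set.infinite_range_of_injective
    (f := fun q => Projectivization.mk ℚ (intRat (v q)) (hv0 q)) fun q q' hqq => ?_).mono ?_
  · by_contra hne
    obtain ⟨i, -, hi⟩ := exists_mul_ne_mul_of_primVectors (fun h => hne (Subtype.ext h))
      (hv q) (hv q')
    obtain ⟨a, ha⟩ := (Projectivization.mk_eq_mk_iff' _ _ _ _ _).mp hqq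
    have h1 := congrFun ha i
    have h2 := congrFun ha j
    simp only [Pi.smul_apply, smul_eq_mul, intRat, (mem_primVectors.mp (hv q)).1,
      (mem_primVectors.mp (hv q')).1] at h1 h2
    refine hi ?_
    have h3 : ((q.1 : ℤ) : ℚ) * (v q' i : ℚ) = ((q'.1 : ℤ) : ℚ) * (v q i : ℚ) := by
      rw [← h1, ← h2]; ring
    exact_mod_cast h3
  · rintro _ ⟨q, rfl⟩
    refine ⟨v q, (mem_primVectors.mp (hv q)).2.2, ⟨hv0 q, rfl⟩, ?_⟩
    rw [Hsup_of_mem_primVectors (hv q)]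
    refine le_trans ?_ (hS q.1 q.2.1).2
    obtain ⟨a, ha⟩ := Projectivization.exists_smul_eq_mk_rep ℚ_[p] x hx0
    rw [← ha]
    have hapos : 0 < ‖(a : ℚ_[p])‖ := norm_pos_iff.mpr a.ne_zero
    refine padicDelta_le (hS q.1 q.2.1).1 (mem_primVectors.mp (hv q)).1
      (mul_ne_zero a.ne_zero hchart.1) (fun i => ?_) (by positivity) fun i hi => ?_
    · simp only [Pi.smul_apply, Units.smul_def, norm_smul]
      exact mul_le_mul_of_nonneg_left (hchart.2.2 i) hapos.le
    · simp only [Pi.smul_apply, Units.smul_def, smul_eq_mul]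
      rw [mul_left_comm, ← mul_sub, norm_mul, norm_mul, mul_left_comm]
      exact mul_le_mul_of_nonneg_left ((hxv q).2 i hi) hapos.le

/-- Discretization of an approximation function to powers of `p`. -/
lemma exists_radius (hn : 2 < n) {ψ : ℕ → ℝ} (hψ : ∀ q, 0 ≤ ψ q) (hψ0 : ∀ q, p ∣ q → ψ q = 0)
    (hdiv : ¬Summable fun q : ℕ => (q : ℝ) ^ (n - 1) * ψ q ^ (n - 1)) :
    ∃ k : ℕ → ℕ, (∀ q, 0 < ψ q → q ≤ p ^ k q ∧ (p : ℝ) ^ (-(k q : ℤ)) ≤ ψ q) ∧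
      ¬Summable ({q | 0 < ψ q}.indicator fun q : ℕ => ((q : ℝ) / p ^ k q) ^ (n - 1)) := by
  have hp1 : (1 : ℝ) < p := by exact_mod_cast (Fact.out : p.Prime).one_lt
  have hp0 : (0 : ℝ) < p := by linarith
  have hd : n - 1 ≠ 0 := by omega
  have hpos : ∀ q, 0 < ψ q → (0 : ℝ) < q := fun q hq => Nat.cast_pos.mpr
    (Nat.pos_of_ne_zero fun h => hq.ne' (hψ0 q (h ▸ dvd_zero p)))
  have hex : ∀ q, 0 < ψ q → ∃ k : ℕ, (p : ℝ) ^ (-(k : ℤ)) < min (ψ q) (q : ℝ)⁻¹ ∧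
      min (ψ q) (q : ℝ)⁻¹ ≤ p * (p : ℝ) ^ (-(k : ℤ)) := fun q hq => by
    have hq1 : (1 : ℝ) ≤ q := by exact_mod_cast Nat.cast_pos.mp (hpos q hq)
    obtain ⟨m, hm1, hm2⟩ := exists_nat_pow_near_of_lt_one
      (lt_min hq (inv_pos.mpr (hpos q hq))) ((min_le_right _ _).trans (inv_le_one_of_one_le₀ hq1))
      (inv_pos.mpr hp0) (inv_lt_one_of_one_lt₀ hp1)
    refine ⟨m + 1, ?_, ?_⟩
    · rwa [zpow_neg, zpow_natCast, ← inv_pow]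
    · rwa [zpow_neg, zpow_natCast, ← inv_pow, pow_succ, mul_left_comm, mul_inv_cancel₀ hp0.ne',
        mul_one]
  choose! k hk1 hk2 using hex
  refine ⟨k, fun q hq => ⟨?_, ((hk1 q hq).trans_le (min_le_left _ _)).le⟩, fun hsum => hdiv ?_⟩
  · have h := (hk1 q hq).trans_le (min_le_right _ _)
    rw [zpow_neg, zpow_natCast, inv_lt_inv₀ (by positivity) (hpos q hq)] at h
    exact_mod_cast h.le
  · have hmin : Summable fun q : ℕ => min (q * ψ q) 1 ^ (n - 1) := by
      refine (hsum.mul_left ((p : ℝ) ^ (n - 1))).of_nonneg_of_le (fun q => ?_) fun q => ?_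
      · have := hψ q
        positivity
      · rcases (hψ q).eq_or_lt with h0 | h0
        · rw [← h0, mul_zero, min_eq_left zero_le_one, zero_pow hd]
          exact mul_nonneg (by positivity) (Set.indicator_nonneg (fun q _ => by positivity) q)
        · rw [Set.indicator_of_mem (s := {q | 0 < ψ q}) h0, ← mul_pow]
          have := hψ q
          refine pow_le_pow_left₀ (by positivity) ?_ _
          calc min (q * ψ q) 1 = q * min (ψ q) (q : ℝ)⁻¹ := by
                rw [mul_min_of_nonneg _ _ (hpos q h0).le, mul_inv_cancel₀ (hpos q h0).ne']
            _ ≤ q * (p * (p : ℝ) ^ (-(k q : ℤ))) :=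
                mul_le_mul_of_nonneg_left (hk2 q h0) (hpos q h0).le
            _ = _ := by rw [zpow_neg, zpow_natCast]; ring
    refine hmin.congr_cofinite ?_
    rw [Nat.cofinite_eq_atTop]
    filter_upwards [hmin.tendsto_atTop_zero.eventually_lt_const zero_lt_one] with q hq
    rw [← mul_pow]
    have h1 : min (q * ψ q) 1 < 1 := by
      by_contra h
      exact absurd (one_le_pow₀ (not_lt.mp h)) (not_le.mpr hq)
    rw [min_eq_left ((min_lt_iff.mp h1).elim le_of_lt fun h => absurd h (lt_irrefl _))]

lemma padicHaar_singleton_zero (j : Fin n) : padicHaar p n {0} = 0 := by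
  have : Nonempty (Fin n) := ⟨j⟩
  have : (nhdsWithin (0 : Fin n → ℚ_[p]) {0}ᶜ).NeBot := Module.punctured_nhds_neBot ℚ_[p] _ 0
  exact measure_singleton 0

lemma padicHaar_chart_diff_eq_zero {j : Fin n} {V : Set (Fin n → ℚ_[p])} (hV : MeasurableSet V)
    (h : (chartMeasure p j).real Set.univ ≤ (chartMeasure p j).real V) :
    padicHaar p n (chart p j \ V) = 0 := by
  have h1 := measureReal_compl (μ := chartMeasure p j) hV
  have h2 : (chartMeasure p j).real Vᶜ = 0 :=
    le_antisymm (by linarith) measureReal_nonneg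
  rw [measureReal_eq_zero_iff, chartMeasure, Measure.restrict_apply hV.compl] at h2
  rwa [Set.sdiff_eq, Set.inter_comm]

lemma exists_mem_chart {x : Fin n → ℚ_[p]} (hx : ∀ i, ‖x i‖ ≤ 1) (hx0 : x ≠ 0) :
    ∃ j, x ∈ chart p j := by
  obtain ⟨i, hi⟩ := Function.ne_iff.mp hx0
  have : Nonempty (Fin n) := ⟨i⟩
  obtain ⟨j, hj⟩ := Finite.exists_max fun i => ‖x i‖
  exact ⟨j, norm_pos_iff.mp ((norm_pos_iff.mpr hi).trans_le (hj i)), hx j, hj⟩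
end Cones

/-- the projective `p`-adic Duffin–Schaeffer theorem: for `n > 2` and `ψ`
vanishing at multiples of `p`, divergence of `Σ q^{n-1} ψ(q)^{n-1}` implies full measure. -/
theorem projective_duffin_schaeffer (n p : ℕ) (hn : 2 < n) [Fact p.Prime]
    (ψ : ℕ → ℝ) (hψ : ∀ q, 0 ≤ ψ q) (hψ0 : ∀ q, p ∣ q → ψ q = 0)
    (hdiv : ¬ Summable fun q : ℕ => (q : ℝ) ^ (n - 1) * ψ q ^ (n - 1)) :
    muP p n (Wp p n ψ) = 1 := by
  obtain ⟨k, hk, hdiv'⟩ := exists_radius hn hψ hψ0 hdiv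
  set S : Set ℕ := {q | 0 < ψ q} with hS
  have hSp : ∀ q ∈ S, ¬p ∣ q := fun q hq h => (hq : 0 < ψ q).ne' (hψ0 q h)
  have hnull : ∀ j : Fin n, padicHaar p n (chart p j \ limsupSet p j S k) = 0 := fun j =>
    padicHaar_chart_diff_eq_zero (measurableSet_limsupSet j S k)
      (chartMeasure_real_univ_le_real_limsupSet hn j (fun q hq => ⟨hSp q hq, (hk q hq).1⟩) hdiv')
  refine le_antisymm ((measure_mono fun x hx => hx.1).trans padicHaar_unitBall.le) ?_
  rw [← padicHaar_unitBall (p := p) (n := n), muP]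
  have hcover : {x : Fin n → ℚ_[p] | ∀ i, ‖x i‖ ≤ 1} ⊆
      {x | (∀ i, ‖x i‖ ≤ 1) ∧ ∃ hx : x ≠ 0, Projectivization.mk ℚ_[p] x hx ∈ Wp p n ψ} ∪
        ({0} ∪ ⋃ j, chart p j \ limsupSet p j S k) := by
    intro x hx
    rcases eq_or_ne x 0 with h0 | h0
    · exact Or.inr (Or.inl h0)
    obtain ⟨j, hj⟩ := exists_mem_chart hx h0
    by_cases hV : x ∈ limsupSet p j S k
    · exact Or.inl ⟨hx, h0,
        mk_mem_Wp_of_mem_limsupSet (fun q hq => ⟨hSp q hq, (hk q hq).2⟩) h0 hV⟩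
    · exact Or.inr (Or.inr (Set.mem_iUnion.mpr ⟨j, hj, hV⟩))
  have hzero : padicHaar p n ({0} ∪ ⋃ j : Fin n, chart p j \ limsupSet p j S k) = 0 :=
    measure_union_null (padicHaar_singleton_zero ⟨0, by omega⟩) (measure_iUnion_null hnull)
  refine (measure_mono hcover).trans ((measure_union_le _ _).trans ?_)
  rw [hzero, add_zero]
end
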